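/- arXiv:2403.03321 — 3 statements merged into one kernel-verified Lean document; each statement's English description precedes it below -/
import Mathlib

section
/- Let M be an n-manifold, S a finite set, and k the cardinality of S. Let U be an open subset of M homeomorphic to ℝⁿ × {1,…,k} (a disjoint union of k open balls). For any embedding φ : U → M, the square of evaluation maps Emb(ℝⁿ×S, U) → Emb(ℝⁿ×S, M), Conf(S, U) → Conf(S, M) (horizontal) and evaluation at origins (vertical) is homotopy cartesian in the Quillen model structure on topological spaces. -/
open Topology

/-! Weak homotopy equivalences and homotopy cartesian squares of topological spaces. -/

/-- The boundary of the `m`-cube `Iᵐ`. -/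
def cubeBoundary (m : ℕ) : Set (Fin m → unitInterval) :=
  {q | ∃ i, q i = 0 ∨ q i = 1}

/-- A map of spaces is a weak homotopy equivalence iff every lifting-extension problem
for cubes relative to their boundaries is solvable: for any `α : ∂Iᵐ → X` and
`β : Iᵐ → Y` with `β|∂ = f ∘ α`, there is an extension `α' : Iᵐ → X` of `α` with
`f ∘ α'` homotopic to `β` rel `∂Iᵐ`.  (This is the standard combinatorial
characterization of weak homotopy equivalences.) -/
def IsWeakHomotopyEquiv {X Y : Type*} [TopologicalSpace X] [TopologicalSpace Y]
    (f : X → Y) : Prop :=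
  Continuous f ∧
  ∀ (m : ℕ) (α : C(cubeBoundary m, X)) (β : C(Fin m → unitInterval, Y)),
    (∀ q : cubeBoundary m, β q.1 = f (α q)) →
    ∃ α' : C(Fin m → unitInterval, X),
      (∀ q : cubeBoundary m, α' q.1 = α q) ∧
      ∃ H : C((Fin m → unitInterval) × unitInterval, Y),
        (∀ q, H (q, 0) = f (α' q)) ∧ (∀ q, H (q, 1) = β q) ∧
        (∀ (q : cubeBoundary m) (t : unitInterval), H (q.1, t) = β q.1)

/-- The (path-space model of the) homotopy pullback of `f : A → Z ← B : g`. -/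
def HPullback {A B Z : Type*} [TopologicalSpace A] [TopologicalSpace B]
    [TopologicalSpace Z] (f : C(A, Z)) (g : C(B, Z)) : Type _ :=
  {p : A × C(unitInterval, Z) × B // p.2.1 0 = f p.1 ∧ p.2.1 1 = g p.2.2}

noncomputable instance {A B Z : Type*} [TopologicalSpace A] [TopologicalSpace B]
    [TopologicalSpace Z] (f : C(A, Z)) (g : C(B, Z)) : TopologicalSpace (HPullback f g) :=
  instTopologicalSpaceSubtype

/-- A strictly commutative square (with top-left corner `W`) is homotopy cartesian if
the canonical map from `W` to the homotopy pullback is a weak homotopy equivalence. -/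
def IsHomotopyCartesian {W A B Z : Type*} [TopologicalSpace W] [TopologicalSpace A]
    [TopologicalSpace B] [TopologicalSpace Z]
    (w : C(W, A)) (v : C(W, B)) (f : C(A, Z)) (g : C(B, Z))
    (hcomm : ∀ x, f (w x) = g (v x)) : Prop :=
  IsWeakHomotopyEquiv (fun x : W =>
    (⟨(w x, ContinuousMap.const unitInterval (f (w x)), v x), rfl, hcomm x⟩ :
      HPullback f g))

/-! Embedding spaces and configuration spaces. -/

/-- The space `Emb(ℝⁿ × S, M)` of open embeddings, with the compact-open topology. -/
def EmbSp (n : ℕ) (S M : Type*) [TopologicalSpace S] [TopologicalSpace M] :=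
  {e : C(EuclideanSpace ℝ (Fin n) × S, M) // IsOpenEmbedding e}

noncomputable instance (n : ℕ) (S M : Type*) [TopologicalSpace S] [TopologicalSpace M] :
    TopologicalSpace (EmbSp n S M) :=
  instTopologicalSpaceSubtype

/-- The configuration space `Conf(S, M)` of injections `S → M`, as a subspace of `Mˢ`. -/
def ConfSp (S M : Type*) [TopologicalSpace M] := {c : S → M // Function.Injective c}

instance (S M : Type*) [TopologicalSpace M] : TopologicalSpace (ConfSp S M) :=
  instTopologicalSpaceSubtype

/-- Evaluation at the origins, as a continuous map `Emb(ℝⁿ × S, M) → Conf(S, M)`. -/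
noncomputable def evalOriginsMap (n : ℕ) (S M : Type*) [TopologicalSpace S]
    [TopologicalSpace M] : C(EmbSp n S M, ConfSp S M) :=
  ⟨fun e => ⟨fun s => e.1 (0, s), fun s t h => by
      simpa using congrArg Prod.snd
        (e.2.injective (a₁ := ((0 : EuclideanSpace ℝ (Fin n)), s)) (a₂ := (0, t)) h)⟩,
    by
      apply Continuous.subtype_mk
      exact continuous_pi fun s =>
        (ContinuousEvalConst.continuous_eval_const ((0 : EuclideanSpace ℝ (Fin n)), s)).comp
          continuous_subtype_val⟩

/-- Postcomposition with an open embedding `φ : U → M`, on embedding spaces. -/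
noncomputable def embPostcomp (n : ℕ) (S U M : Type*) [TopologicalSpace S]
    [TopologicalSpace U] [TopologicalSpace M] (φ : C(U, M)) (hφ : IsOpenEmbedding φ) :
    C(EmbSp n S U, EmbSp n S M) :=
  ⟨fun e => ⟨φ.comp e.1, hφ.comp e.2⟩,
    by
      apply Continuous.subtype_mk
      exact (ContinuousMap.continuous_postcomp φ).comp continuous_subtype_val⟩

/-- Postcomposition with an open embedding `φ : U → M`, on configuration spaces. -/
noncomputable def confPostcomp (S U M : Type*) [TopologicalSpace U] [TopologicalSpace M]
    (φ : C(U, M)) (hφ : IsOpenEmbedding φ) : C(ConfSp S U, ConfSp S M) :=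
  ⟨fun c => ⟨fun s => φ (c.1 s), fun s t h => c.2 (hφ.injective h)⟩,
    by
      apply Continuous.subtype_mk
      exact continuous_pi fun s =>
        φ.continuous.comp ((continuous_apply s).comp continuous_subtype_val)⟩

/-! ## Auxiliary facts on maps out of `E × S` with `S` discrete -/

theorem nhds_prod_discrete {E S : Type*} [TopologicalSpace E] [TopologicalSpace S]
    [DiscreteTopology S] (y : E) (j : S) : 𝓝 (y, j) = Filter.map (fun z => (z, j)) (𝓝 y) := by
  rw [nhds_prod_eq, nhds_discrete S, Filter.prod_pure]

theorem isOpenMap_prod_discrete {E S M : Type*} [TopologicalSpace E] [TopologicalSpace S]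
    [TopologicalSpace M] [DiscreteTopology S] (F : E × S → M)
    (hF : ∀ j, IsOpenMap (fun y => F (y, j))) : IsOpenMap F := by
  rw [isOpenMap_iff_nhds_le]
  rintro ⟨y, j⟩
  rw [nhds_prod_discrete, Filter.map_map]
  exact (hF j).nhds_le y

/-- The compactly supported push moving `a` to `b`. -/
noncomputable def pushMap {E : Type*} [NormedAddCommGroup E] [NormedSpace ℝ E] (a b x : E) : E :=
  x + (max 0 (1 - 2 * ‖x - a‖)) • (b - a)

section push
variable {E : Type*} [NormedAddCommGroup E] [NormedSpace ℝ E]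

theorem pushMap_self (a x : E) : pushMap a a x = x := by simp [pushMap]

theorem pushMap_apply (a b : E) : pushMap a b a = b := by simp [pushMap]

theorem pushMap_far (a b x : E) (ha : ‖a‖ < 1/4) (hx : 1 ≤ ‖x‖) : pushMap a b x = x := by
  have h1 : ‖x‖ - ‖a‖ ≤ ‖x - a‖ := norm_sub_norm_le x a
  have : max 0 (1 - 2 * ‖x - a‖) = 0 := max_eq_left (by linarith)
  simp [pushMap, this]

theorem pushMap_isOpenEmbedding [CompleteSpace E] (a b : E) (ha : ‖a‖ < 1/4) (hb : ‖b‖ < 1/4) :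
    IsOpenEmbedding (pushMap a b) := by
  have hba : ‖b - a‖ < 1/2 := by
    have := norm_sub_le b a
    linarith
  let c : NNReal := ⟨2 * ‖b - a‖, by positivity⟩
  have hf : ApproximatesLinearOn (pushMap a b)
      ((ContinuousLinearEquiv.refl ℝ E : E ≃L[ℝ] E) : E →L[ℝ] E) Set.univ c := by
    intro x _ y _
    have h1 : pushMap a b x - pushMap a b y -
        ((ContinuousLinearEquiv.refl ℝ E : E ≃L[ℝ] E) : E →L[ℝ] E) (x - y)
        = (max 0 (1 - 2 * ‖x - a‖) - max 0 (1 - 2 * ‖y - a‖)) • (b - a) := by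
      simp only [pushMap, sub_smul, ContinuousLinearEquiv.coe_coe,
        ContinuousLinearEquiv.refl_apply]
      abel
    rw [h1, norm_smul]
    have h2 : |max 0 (1 - 2 * ‖x - a‖) - max 0 (1 - 2 * ‖y - a‖)| ≤ 2 * ‖x - y‖ := by
      have h3 := abs_max_sub_max_le_abs (1 - 2 * ‖x - a‖) (1 - 2 * ‖y - a‖) 0
      rw [max_comm 0, max_comm 0]
      refine h3.trans ?_
      have h4 := abs_norm_sub_norm_le (x - a) (y - a)
      rw [sub_sub_sub_cancel_right] at h4
      rw [abs_le] at h4 ⊢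
      constructor <;> linarith [h4.1, h4.2]
    have : (c : ℝ) = 2 * ‖b - a‖ := rfl
    rw [this, Real.norm_eq_abs]
    nlinarith [norm_nonneg (b - a)]
  have hc : Subsingleton E ∨
      c < ‖((ContinuousLinearEquiv.refl ℝ E : E ≃L[ℝ] E).symm : E →L[ℝ] E)‖₊⁻¹ := by
    rcases subsingleton_or_nontrivial E with h | h
    · exact Or.inl h
    · right
      have : ‖((ContinuousLinearEquiv.refl ℝ E : E ≃L[ℝ] E).symm : E →L[ℝ] E)‖₊ = 1 := by
        apply NNReal.eq
        simp
      rw [this, inv_one]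
      apply NNReal.coe_lt_coe.1
      change 2 * ‖b - a‖ < 1
      linarith
  exact (hf.toHomeomorph _ hc).isOpenEmbedding

theorem continuous_pushMap {Y : Type*} [TopologicalSpace Y] {a b x : Y → E}
    (ha : Continuous a) (hb : Continuous b) (hx : Continuous x) :
    Continuous (fun y => pushMap (a y) (b y) (x y)) := by
  unfold pushMap
  fun_prop

end push

/-- A quarter-ball worth of coordinates for each `s`. -/
abbrev QB (S E : Type*) [NormedAddCommGroup E] := {A : S → E // ∀ s, ‖A s‖ < 1/4}

open Classical in
/-- The push along an embedding `h`, extended by the identity. -/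
noncomputable def bigPush {E S M : Type*} [NormedAddCommGroup E] [NormedSpace ℝ E]
    (h : E × S → M) (A B : S → E) (x : M) : M :=
  if hx : ∃ p, h p = x then
    h (pushMap (A hx.choose.2) (B hx.choose.2) hx.choose.1, hx.choose.2) else x

open Classical in
/-- Coordinates of a point in the image of `h`. -/
noncomputable def coordOf {E S M : Type*} [NormedAddCommGroup E] [NormedSpace ℝ E]
    (h : E × S → M) (x : M) : E :=
  if hx : ∃ p, h p = x then hx.choose.1 else 0

section big
set_option linter.unusedSectionVars false
variable {E S M : Type*} [NormedAddCommGroup E] [NormedSpace ℝ E] {h : E × S → M}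

theorem bigPush_apply (hi : Function.Injective h) (A B : S → E) (p : E × S) :
    bigPush h A B (h p) = h (pushMap (A p.2) (B p.2) p.1, p.2) := by
  have hx : ∃ p', h p' = h p := ⟨p, rfl⟩
  have : hx.choose = p := hi hx.choose_spec
  rw [bigPush, dif_pos hx, this]

theorem bigPush_notMem (A B : S → E) (x : M) (hx : x ∉ Set.range h) :
    bigPush h A B x = x := by
  unfold bigPush
  exact dif_neg hx

theorem coordOf_apply (hi : Function.Injective h) (p : E × S) :
    coordOf h (h p) = p.1 := by
  have hx : ∃ p', h p' = h p := ⟨p, rfl⟩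
  have : hx.choose = p := hi hx.choose_spec
  rw [coordOf, dif_pos hx, this]

theorem bigPush_far (hi : Function.Injective h) (A B : QB S E) (x : M)
    (hx : x ∉ h '' (Metric.closedBall 0 1 ×ˢ Set.univ)) :
    bigPush h A.1 B.1 x = x := by
  by_cases hr : x ∈ Set.range h
  · obtain ⟨p, rfl⟩ := hr
    rw [bigPush_apply hi, pushMap_far _ _ _ (A.2 _)]
    by_contra hp
    exact hx ⟨p, ⟨by simpa using (not_le.1 hp).le, trivial⟩, rfl⟩
  · exact bigPush_notMem _ _ _ hr

theorem bigPush_self (hi : Function.Injective h) (A : S → E) (x : M) :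
    bigPush h A A x = x := by
  by_cases hr : x ∈ Set.range h
  · obtain ⟨p, rfl⟩ := hr
    rw [bigPush_apply hi, pushMap_self]
  · exact bigPush_notMem _ _ _ hr

variable [TopologicalSpace M] [T2Space M] [TopologicalSpace S] [DiscreteTopology S] [Finite S]
  [FiniteDimensional ℝ E]

theorem isClosed_core (hh : IsOpenEmbedding h) :
    IsClosed (h '' (Metric.closedBall 0 1 ×ˢ Set.univ)) := by
  have : ProperSpace E := FiniteDimensional.proper ℝ E
  exact (((isCompact_closedBall 0 1).prod isCompact_univ).image hh.continuous).isClosed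

theorem continuous_bigPush (hh : IsOpenEmbedding h) :
    Continuous (fun z : QB S E × QB S E × M => bigPush h z.1.1 z.2.1.1 z.2.2) := by
  rw [continuous_iff_continuousAt]
  rintro ⟨A, B, x⟩
  by_cases hr : x ∈ Set.range h
  · obtain ⟨p, rfl⟩ := hr
    have hemb : IsOpenEmbedding (Prod.map id (Prod.map id h) :
        QB S E × QB S E × (E × S) → QB S E × QB S E × M) :=
      IsOpenEmbedding.id.prodMap (IsOpenEmbedding.id.prodMap hh)
    have := hemb.continuousAt_iff
      (g := fun z : QB S E × QB S E × M => bigPush h z.1.1 z.2.1.1 z.2.2) (x := (A, B, p))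
    refine this.1 ?_
    have h2 : ((fun z : QB S E × QB S E × M => bigPush h z.1.1 z.2.1.1 z.2.2) ∘
        (Prod.map id (Prod.map id h))) = fun z : QB S E × QB S E × (E × S) =>
        h (pushMap (z.1.1 z.2.2.2) (z.2.1.1 z.2.2.2) z.2.2.1, z.2.2.2) := by
      funext z
      exact bigPush_apply hh.injective _ _ _
    rw [h2]
    apply Continuous.continuousAt
    apply hh.continuous.comp
    refine Continuous.prodMk ?_ (by fun_prop)
    have hev : Continuous (fun z : (S → E) × S => z.1 z.2) := by
      rw [continuous_iff_continuousAt]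
      rintro ⟨f, j⟩
      rw [ContinuousAt, nhds_prod_discrete, Filter.tendsto_map'_iff]
      exact (continuous_apply j).continuousAt
    refine continuous_pushMap ?_ ?_ (by fun_prop)
    · exact hev.comp ((continuous_subtype_val.comp continuous_fst).prodMk (by fun_prop))
    · exact hev.comp ((continuous_subtype_val.comp
        (continuous_fst.comp continuous_snd)).prodMk (by fun_prop))
  · have hx : x ∈ (h '' (Metric.closedBall 0 1 ×ˢ Set.univ))ᶜ :=
      fun hx => hr (Set.image_subset_range _ _ hx)
    have hev : (fun z : QB S E × QB S E × M => bigPush h z.1.1 z.2.1.1 z.2.2)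
        =ᶠ[𝓝 (A, B, x)] fun z => z.2.2 := by
      have ho : IsOpen {z : QB S E × QB S E × M |
          z.2.2 ∈ (h '' (Metric.closedBall 0 1 ×ˢ Set.univ))ᶜ} :=
        (isClosed_core hh).isOpen_compl.preimage (by fun_prop)
      filter_upwards [ho.mem_nhds hx] with z hz
      exact bigPush_far hh.injective _ _ _ hz
    exact (ContinuousAt.congr (by fun_prop) hev.symm)

theorem bigPush_isOpenEmbedding (hh : IsOpenEmbedding h) (A B : QB S E) :
    IsOpenEmbedding (bigPush h A.1 B.1) := by
  have : CompleteSpace E := FiniteDimensional.complete ℝ E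
  rw [isOpenEmbedding_iff_continuous_injective_isOpenMap]
  refine ⟨(continuous_bigPush hh).comp (Continuous.prodMk continuous_const
    (Continuous.prodMk continuous_const continuous_id)) , ?_, ?_⟩
  · intro x y hxy
    by_cases hx : x ∈ Set.range h <;> by_cases hy : y ∈ Set.range h
    · obtain ⟨p, rfl⟩ := hx
      obtain ⟨p', rfl⟩ := hy
      rw [bigPush_apply hh.injective, bigPush_apply hh.injective] at hxy
      have h1 := hh.injective hxy
      obtain ⟨a, j⟩ := p
      obtain ⟨a', j'⟩ := p'
      simp only [Prod.mk.injEq] at h1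
      obtain ⟨h1, rfl⟩ := h1
      rw [(pushMap_isOpenEmbedding _ _ (A.2 j) (B.2 j)).injective h1]
    · obtain ⟨p, rfl⟩ := hx
      rw [bigPush_apply hh.injective, bigPush_notMem _ _ _ hy] at hxy
      exact absurd ⟨_, hxy⟩ hy
    · obtain ⟨p, rfl⟩ := hy
      rw [bigPush_apply hh.injective, bigPush_notMem _ _ _ hx] at hxy
      exact absurd ⟨_, hxy.symm⟩ hx
    · rwa [bigPush_notMem _ _ _ hx, bigPush_notMem _ _ _ hy] at hxy
  · rw [isOpenMap_iff_nhds_le]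
    intro x
    by_cases hx : x ∈ Set.range h
    · obtain ⟨p, rfl⟩ := hx
      have hcomp : bigPush h A.1 B.1 ∘ h =
          fun p : E × S => h (pushMap (A.1 p.2) (B.1 p.2) p.1, p.2) := by
        funext p
        exact bigPush_apply hh.injective _ _ _
      have ho : IsOpenMap (fun p : E × S => h (pushMap (A.1 p.2) (B.1 p.2) p.1, p.2)) := by
        apply isOpenMap_prod_discrete
        intro j
        have h1 : IsOpenMap (fun y : E => (y, j)) := by
          rw [isOpenMap_iff_nhds_le]
          intro y
          rw [nhds_prod_discrete]
        exact hh.isOpenMap.comp (h1.comp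
          (pushMap_isOpenEmbedding _ _ (A.2 j) (B.2 j)).isOpenMap)
      rw [← hh.map_nhds_eq, Filter.map_map, hcomp, bigPush_apply hh.injective]
      exact ho.nhds_le p
    · have hx' : x ∈ (h '' (Metric.closedBall 0 1 ×ˢ Set.univ))ᶜ :=
        fun hx' => hx (Set.image_subset_range _ _ hx')
      have hev : bigPush h A.1 B.1 =ᶠ[𝓝 x] id := by
        filter_upwards [(isClosed_core hh).isOpen_compl.mem_nhds hx'] with z hz
        exact bigPush_far hh.injective _ _ _ hz
      rw [Filter.map_congr hev, Filter.map_id, bigPush_notMem _ _ _ hx]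

/-- Local transport from an embedding. -/
theorem exists_transport_of_emb (hh : IsOpenEmbedding h) (c₀ : ConfSp S M)
    (hc₀ : ∀ s, h (0, s) = c₀.1 s) :
    ∃ N : Set (ConfSp S M), IsOpen N ∧ c₀ ∈ N ∧ ∃ Ψ : N × N × M → M, Continuous Ψ ∧
      (∀ c c', IsOpenEmbedding (fun x => Ψ (c, c', x))) ∧ (∀ c x, Ψ (c, c, x) = x) ∧
      (∀ c c' s, Ψ (c, c', c.1.1 s) = c'.1.1 s) := by
  let N : Set (ConfSp S M) := {c | ∀ s, c.1 s ∈ h '' (Metric.ball 0 (1/4) ×ˢ {s})}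
  have hev : ∀ s, Continuous (fun c : ConfSp S M => c.1 s) := fun s =>
    (continuous_apply s).comp continuous_subtype_val
  have hmem : ∀ (c : N) s, ∃ y : E, ‖y‖ < 1/4 ∧ h (y, s) = c.1.1 s := by
    intro c s
    obtain ⟨⟨y, s'⟩, ⟨hy, hs⟩, hys⟩ := c.2 s
    simp only [Set.mem_singleton_iff] at hs
    subst hs
    exact ⟨y, by simpa using hy, hys⟩
  have hco : ∀ (c : N) s, ‖coordOf h (c.1.1 s)‖ < 1/4 ∧
      h (coordOf h (c.1.1 s), s) = c.1.1 s := by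
    intro c s
    obtain ⟨y, hy, hys⟩ := hmem c s
    rw [← hys, coordOf_apply hh.injective]
    exact ⟨hy, rfl⟩
  let A : N → QB S E := fun c => ⟨fun s => coordOf h (c.1.1 s), fun s => (hco c s).1⟩
  have hA : Continuous A := by
    apply Continuous.subtype_mk
    refine continuous_pi fun s => ?_
    rw [continuous_iff_continuousAt]
    intro c
    have h1 : ContinuousAt (coordOf h) (c.1.1 s) := by
      rw [← (hco c s).2, ← hh.continuousAt_iff]
      have : coordOf h ∘ h = Prod.fst := funext fun p => coordOf_apply hh.injective p
      rw [this]
      exact continuous_fst.continuousAt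
    exact ContinuousAt.comp (g := coordOf h) (f := fun c : N => c.1.1 s) h1
      ((hev s).comp continuous_subtype_val).continuousAt
  refine ⟨N, ?_, ?_, fun z => bigPush h (A z.1).1 (A z.2.1).1 z.2.2, ?_, ?_, ?_, ?_⟩
  · have : N = ⋂ s, (fun c : ConfSp S M => c.1 s) ⁻¹' (h '' (Metric.ball 0 (1/4) ×ˢ {s})) := by
      ext c
      simp [N]
    rw [this]
    refine isOpen_iInter_of_finite fun s => IsOpen.preimage (hev s) ?_
    exact hh.isOpenMap _ (Metric.isOpen_ball.prod (isOpen_discrete _))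
  · intro s
    exact ⟨(0, s), ⟨by simp, rfl⟩, hc₀ s⟩
  · exact (continuous_bigPush hh).comp ((hA.comp continuous_fst).prodMk
      ((hA.comp (continuous_fst.comp continuous_snd)).prodMk
        (continuous_snd.comp continuous_snd)))
  · intro c c'
    exact bigPush_isOpenEmbedding hh (A c) (A c')
  · intro c x
    exact bigPush_self hh.injective _ _
  · intro c c' s
    have h1 := bigPush_apply hh.injective (A c).1 (A c').1 (coordOf h (c.1.1 s), s)
    rw [(hco c s).2] at h1
    change bigPush h (A c).1 (A c').1 (c.1.1 s) = _
    rw [h1]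
    change h (pushMap (coordOf h (c.1.1 s)) (coordOf h (c'.1.1 s)) (coordOf h (c.1.1 s)), s) = _
    rw [pushMap_apply, (hco c' s).2]

end big

/-- Any configuration in a manifold is the origins of an embedding. -/
theorem exists_emb_of_conf (n : ℕ) (M : Type*) [TopologicalSpace M]
    [ChartedSpace (EuclideanSpace ℝ (Fin n)) M] [T2Space M]
    (S : Type*) [Finite S] [TopologicalSpace S] [DiscreteTopology S] (c₀ : ConfSp S M) :
    ∃ h : EuclideanSpace ℝ (Fin n) × S → M, IsOpenEmbedding h ∧ ∀ s, h (0, s) = c₀.1 s := by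
  obtain ⟨O, hO, hdisj⟩ := (Set.finite_range c₀.1).t2_separation
  have key : ∀ s, ∃ g : EuclideanSpace ℝ (Fin n) → M, IsOpenEmbedding g ∧ g 0 = c₀.1 s ∧
      Set.range g ⊆ O (c₀.1 s) := by
    intro s
    let e := chartAt (EuclideanSpace ℝ (Fin n)) (c₀.1 s)
    have hs : c₀.1 s ∈ e.source := mem_chart_source _ _
    have ho : IsOpen (e.target ∩ e.symm ⁻¹' (O (c₀.1 s))) :=
      e.isOpen_inter_preimage_symm (hO _).2
    have hm : e (c₀.1 s) ∈ e.target ∩ e.symm ⁻¹' (O (c₀.1 s)) :=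
      ⟨e.map_source hs, by simpa [e.left_inv hs] using (hO _).1⟩
    obtain ⟨r, hr, hball⟩ := Metric.isOpen_iff.1 ho _ hm
    let f := OpenPartialHomeomorph.univBall (e (c₀.1 s)) r
    have hf : ∀ x, f x ∈ e.target ∩ e.symm ⁻¹' (O (c₀.1 s)) := by
      intro x
      apply hball
      rw [← OpenPartialHomeomorph.univBall_target _ hr]
      exact f.map_source (by simp [f])
    refine ⟨f.trans e.symm, OpenPartialHomeomorph.isOpenEmbedding _ ?_, ?_, ?_⟩
    · ext x
      simp only [OpenPartialHomeomorph.trans_source, Set.mem_inter_iff, Set.mem_univ, iff_true]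
      exact ⟨by simp [f], (hf x).1⟩
    · simp [f, e.left_inv hs]
    · rintro _ ⟨x, rfl⟩
      exact (hf x).2
  choose g hg hg0 hgr using key
  refine ⟨fun p => g p.2 p.1, ?_, fun s => hg0 s⟩
  rw [isOpenEmbedding_iff_continuous_injective_isOpenMap]
  refine ⟨?_, ?_, isOpenMap_prod_discrete _ fun j => (hg j).isOpenMap⟩
  · rw [continuous_iff_continuousAt]
    rintro ⟨y, j⟩
    rw [ContinuousAt, nhds_prod_discrete, Filter.tendsto_map'_iff]
    exact (hg j).continuous.continuousAt
  · rintro ⟨y, j⟩ ⟨y', j'⟩ hyy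
    change g j y = g j' y' at hyy
    have hj : j = j' := by
      by_contra hne
      have hne' : c₀.1 j ≠ c₀.1 j' := fun hc => hne (c₀.2 hc)
      have := hdisj ⟨j, rfl⟩ ⟨j', rfl⟩ hne'
      exact Set.disjoint_left.1 this (hgr j ⟨y, rfl⟩) (hyy ▸ hgr j' ⟨y', rfl⟩)
    subst hj
    rw [(hg j).injective hyy]

/-- Local transport in configuration spaces of manifolds. -/
theorem exists_transport (n : ℕ) (M : Type*) [TopologicalSpace M]
    [ChartedSpace (EuclideanSpace ℝ (Fin n)) M] [T2Space M]
    (S : Type*) [Finite S] [TopologicalSpace S] [DiscreteTopology S] (c₀ : ConfSp S M) :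
    ∃ N : Set (ConfSp S M), IsOpen N ∧ c₀ ∈ N ∧ ∃ Ψ : N × N × M → M, Continuous Ψ ∧
      (∀ c c', IsOpenEmbedding (fun x => Ψ (c, c', x))) ∧ (∀ c x, Ψ (c, c, x) = x) ∧
      (∀ c c' s, Ψ (c, c', c.1.1 s) = c'.1.1 s) := by
  obtain ⟨h, hh, h0⟩ := exists_emb_of_conf n M S c₀
  exact exists_transport_of_emb hh c₀ h0

/-- `σ` lifts to a family of embeddings agreeing with `F₀` on `K`. -/
def LiftsTo {Y E S M : Type*} [TopologicalSpace Y] [NormedAddCommGroup E] [TopologicalSpace S]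
    [TopologicalSpace M] (F₀ : Y → E × S → M) (K : Set Y) (σ : Y → ConfSp S M) : Prop :=
  ∃ F : Y → E × S → M, Continuous (fun z : Y × (E × S) => F z.1 z.2) ∧
    (∀ y, IsOpenEmbedding (F y)) ∧ (∀ y s, F y (0, s) = (σ y).1 s) ∧ ∀ y ∈ K, F y = F₀ y

open Classical in
theorem LiftsTo.step {Y E S M : Type*} [TopologicalSpace Y] [NormedAddCommGroup E]
    [TopologicalSpace S] [TopologicalSpace M] {F₀ : Y → E × S → M} {K : Set Y}
    {σ σ' : Y → ConfSp S M} (hσ : Continuous σ) (hσ' : Continuous σ') (hl : LiftsTo F₀ K σ)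
    (N : Set (ConfSp S M)) (Ψ : N × N × M → M) (hΨ : Continuous Ψ)
    (hemb : ∀ c c', IsOpenEmbedding (fun x => Ψ (c, c', x))) (hid : ∀ c x, Ψ (c, c, x) = x)
    (hmv : ∀ c c' s, Ψ (c, c', c.1.1 s) = c'.1.1 s)
    (V Z : Set Y) (hV : IsOpen V) (hZ : IsClosed Z) (hZV : Z ⊆ V)
    (hN : ∀ y ∈ V, σ y ∈ N) (hN' : ∀ y ∈ V, σ' y ∈ N) (hout : ∀ y ∉ Z, σ y = σ' y)
    (hK : ∀ y ∈ K, σ y = σ' y) : LiftsTo F₀ K σ' := by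
  obtain ⟨F, hF, hFe, hF0, hFK⟩ := hl
  let G : Y → E × S → M := fun y p =>
    if hy : y ∈ V then Ψ (⟨σ y, hN y hy⟩, ⟨σ' y, hN' y hy⟩, F y p) else F y p
  have hGV : ∀ y (hy : y ∈ V) p, G y p = Ψ (⟨σ y, hN y hy⟩, ⟨σ' y, hN' y hy⟩, F y p) :=
    fun y hy p => dif_pos hy
  have hGe : ∀ y, σ y = σ' y → G y = F y := by
    intro y hy
    funext p
    by_cases hyV : y ∈ V
    · rw [hGV y hyV]
      have : (⟨σ' y, hN' y hyV⟩ : N) = ⟨σ y, hN y hyV⟩ := Subtype.ext hy.symm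
      rw [this, hid]
    · exact dif_neg hyV
  refine ⟨G, ?_, ?_, ?_, ?_⟩
  · rw [continuous_iff_continuousAt]
    rintro ⟨y, p⟩
    by_cases hy : y ∈ V
    · have ho : IsOpenEmbedding (Prod.map (Subtype.val : V → Y) (id : E × S → E × S)) :=
        hV.isOpenEmbedding_subtypeVal.prodMap IsOpenEmbedding.id
      have := ho.continuousAt_iff (g := fun z : Y × (E × S) => G z.1 z.2) (x := (⟨y, hy⟩, p))
      refine this.1 ?_
      have h2 : (fun z : Y × (E × S) => G z.1 z.2) ∘
          (Prod.map (Subtype.val : V → Y) (id : E × S → E × S)) = fun z : V × (E × S) =>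
          Ψ (⟨σ z.1, hN z.1 z.1.2⟩, ⟨σ' z.1, hN' z.1 z.1.2⟩, F z.1 z.2) := by
        funext z
        exact hGV _ z.1.2 _
      rw [h2]
      apply Continuous.continuousAt
      refine hΨ.comp (Continuous.prodMk ?_ (Continuous.prodMk ?_ ?_))
      · exact Continuous.subtype_mk (hσ.comp (continuous_subtype_val.comp continuous_fst)) _
      · exact Continuous.subtype_mk (hσ'.comp (continuous_subtype_val.comp continuous_fst)) _
      · exact hF.comp ((continuous_subtype_val.comp continuous_fst).prodMk continuous_snd)
    · have hyZ : y ∈ Zᶜ := fun h => hy (hZV h)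
      have ho : IsOpen {z : Y × (E × S) | z.1 ∈ Zᶜ} := hZ.isOpen_compl.preimage continuous_fst
      refine hF.continuousAt.congr ?_
      filter_upwards [ho.mem_nhds hyZ] with z hz
      rw [hGe _ (hout _ hz)]
  · intro y
    by_cases hy : y ∈ V
    · have : G y = (fun x => Ψ (⟨σ y, hN y hy⟩, ⟨σ' y, hN' y hy⟩, x)) ∘ F y :=
        funext fun p => hGV y hy p
      rw [this]
      exact (hemb _ _).comp (hFe y)
    · rw [hGe y (hout y fun h => hy (hZV h))]
      exact hFe y
  · intro y s
    by_cases hy : y ∈ V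
    · rw [hGV y hy, hF0]
      exact hmv ⟨σ y, hN y hy⟩ ⟨σ' y, hN' y hy⟩ s
    · have h1 := hout y fun h => hy (hZV h)
      rw [hGe y h1, hF0, h1]
  · intro y hy
    rw [hGe y (hK y hy), hFK y hy]

/-- The covering homotopy property, relative to the locus where the homotopy is constant. -/
theorem lift_homotopy (n : ℕ) (M : Type*) [TopologicalSpace M]
    [ChartedSpace (EuclideanSpace ℝ (Fin n)) M] [T2Space M]
    (S : Type*) [Finite S] [TopologicalSpace S] [DiscreteTopology S]
    {Y : Type*} [MetricSpace Y] [CompactSpace Y] (Γ : Y × ℝ → ConfSp S M) (hΓ : Continuous Γ)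
    (F₀ : Y → EuclideanSpace ℝ (Fin n) × S → M) (K : Set Y)
    (hK : ∀ y ∈ K, ∀ u u', Γ (y, u) = Γ (y, u'))
    (h0 : LiftsTo F₀ K (fun y => Γ (y, 0))) : LiftsTo F₀ K (fun y => Γ (y, 1)) := by
  choose N hNo hcN Ψ hΨ hemb hid hmv using exists_transport n M S
  obtain ⟨δ, hδ, hleb⟩ := lebesgue_number_lemma_of_metric
    (s := (Set.univ : Set Y) ×ˢ Set.Icc (0 : ℝ) 1) (c := fun c => Γ ⁻¹' (N c))
    (isCompact_univ.prod isCompact_Icc) (fun c => (hNo c).preimage hΓ)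
    (fun z _ => Set.mem_iUnion.2 ⟨Γ z, hcN _⟩)
  obtain ⟨t, -, ht, hcov⟩ := (isCompact_univ (X := Y)).finite_cover_balls (e := δ/4) (by positivity)
  have hstep : ∀ u u' : ℝ, 0 ≤ u → u ≤ u' → u' ≤ 1 → u' ≤ u + δ/2 →
      LiftsTo F₀ K (fun y => Γ (y, u)) → LiftsTo F₀ K (fun y => Γ (y, u')) := by
    intro u u' hu huu hu1 huδ hl
    let g : Y → Y → ℝ := fun i y => max 0 (2 - dist y i / (δ/4))
    have hg : ∀ i, Continuous (g i) := by
      intro i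
      simp only [g]
      fun_prop
    have hg0 : ∀ i y, 0 ≤ g i y := fun i y => le_max_left _ _
    have main : ∀ l : Finset Y,
        LiftsTo F₀ K (fun y => Γ (y, min u' (u + (δ/2) * ∑ i ∈ l, g i y))) := by
      classical
      intro l
      induction l using Finset.induction_on with
      | empty => simpa [min_eq_right huu] using hl
      | insert i l hi ih =>
        obtain ⟨c, hc⟩ := hleb (i, u) ⟨trivial, hu, huu.trans hu1⟩
        have hcont : ∀ l : Finset Y,
            Continuous (fun y => Γ (y, min u' (u + (δ/2) * ∑ i ∈ l, g i y))) := by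
          intro l
          refine hΓ.comp (continuous_id.prodMk ?_)
          exact continuous_const.min (continuous_const.add (continuous_const.mul
            (continuous_finsetSum _ fun i _ => hg i)))
        have hin : ∀ l : Finset Y, ∀ y ∈ Metric.ball i δ,
            Γ (y, min u' (u + (δ/2) * ∑ i ∈ l, g i y)) ∈ N c := by
          intro l y hy
          apply hc
          rw [Metric.mem_ball, Prod.dist_eq]
          refine max_lt hy ?_
          have hs : 0 ≤ ∑ i ∈ l, g i y := Finset.sum_nonneg fun i _ => hg0 i y
          have h1 : u ≤ min u' (u + (δ/2) * ∑ i ∈ l, g i y) :=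
            le_min huu (le_add_of_nonneg_right (by positivity))
          have h2 : min u' (u + (δ/2) * ∑ i ∈ l, g i y) ≤ u' := min_le_left _ _
          rw [Real.dist_eq, abs_lt]
          constructor <;> simp only <;> linarith
        refine LiftsTo.step (hcont l) (hcont _) ih (N c) (Ψ c) (hΨ c) (hemb c) (hid c) (hmv c)
          (Metric.ball i δ) (Metric.closedBall i (δ/2)) Metric.isOpen_ball
          Metric.isClosed_closedBall (Metric.closedBall_subset_ball (by linarith))
          (hin _) (hin _) ?_ (fun y hy => hK y hy _ _)
        intro y hy
        have hgi : g i y = 0 := by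
          apply max_eq_left
          rw [Metric.mem_closedBall, not_le] at hy
          rw [sub_nonpos, le_div_iff₀ (by positivity)]
          linarith
        rw [Finset.sum_insert hi, hgi, zero_add]
    have hfin := main ht.toFinset
    convert hfin using 4 with y
    symm
    apply min_eq_left
    obtain ⟨i, hi, hyi⟩ := Set.mem_iUnion₂.1 (hcov (Set.mem_univ y))
    have h1 : 1 ≤ g i y := by
      apply le_max_of_le_right
      rw [Metric.mem_ball] at hyi
      have : dist y i / (δ/4) ≤ 1 := by
        rw [div_le_one (by positivity)]
        exact hyi.le
      linarith
    have h2 : g i y ≤ ∑ i ∈ ht.toFinset, g i y :=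
      Finset.single_le_sum (f := fun i => g i y) (fun i _ => hg0 i y) (ht.mem_toFinset.2 hi)
    nlinarith
  have hind : ∀ k : ℕ, LiftsTo F₀ K (fun y => Γ (y, min 1 (k * (δ/2)))) := by
    intro k
    induction k with
    | zero => simpa using h0
    | succ k ih =>
      refine hstep _ _ (by positivity) ?_ (min_le_left _ _) ?_ ih
      · apply min_le_min_left
        push_cast
        nlinarith
      · push_cast
        rcases le_total 1 (k * (δ/2)) with h | h
        · rw [min_eq_left h]
          linarith [min_le_left 1 ((k + 1) * (δ/2))]
        · rw [min_eq_right h]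
          linarith [min_le_right 1 ((k + 1) * (δ/2))]
  obtain ⟨k, hk⟩ := exists_nat_ge (1 / (δ/2))
  have := hind k
  rw [div_le_iff₀ (by positivity)] at hk
  rwa [min_eq_left hk] at this

/-- Radial shrinking of `E` onto the ball of radius `1/s`. -/
noncomputable def shrinkMap {E : Type*} [NormedAddCommGroup E] [NormedSpace ℝ E] (s : ℝ) (x : E) :
    E := (1 + s * ‖x‖)⁻¹ • x

section shrink
variable {E : Type*} [NormedAddCommGroup E] [NormedSpace ℝ E]

theorem shrinkMap_zero_left (x : E) : shrinkMap 0 x = x := by simp [shrinkMap]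

theorem shrinkMap_zero_right (s : ℝ) : shrinkMap s (0 : E) = 0 := by simp [shrinkMap]

theorem shrinkMap_norm (s : ℝ) (hs : 0 ≤ s) (x : E) : s * ‖shrinkMap s x‖ < 1 := by
  have h1 : 0 < 1 + s * ‖x‖ := by positivity
  rw [shrinkMap, norm_smul, norm_inv, Real.norm_eq_abs, abs_of_pos h1]
  have : s * ((1 + s * ‖x‖)⁻¹ * ‖x‖) = (s * ‖x‖) / (1 + s * ‖x‖) := by
    field_simp
  rw [this, div_lt_one h1]
  linarith

theorem shrinkMap_continuous {Y : Type*} [TopologicalSpace Y] {s : Y → ℝ} {x : Y → E}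
    (hs : Continuous s) (hx : Continuous x) (h0 : ∀ y, 0 ≤ s y) :
    Continuous (fun y => shrinkMap (s y) (x y)) := by
  unfold shrinkMap
  refine Continuous.smul (Continuous.inv₀ (by fun_prop) ?_) hx
  intro y
  have := h0 y
  positivity

theorem shrinkMap_isOpenEmbedding (s : ℝ) (hs : 0 ≤ s) :
    IsOpenEmbedding (shrinkMap s : E → E) := by
  have hopen : IsOpen {y : E | s * ‖y‖ < 1} :=
    isOpen_lt (by fun_prop) continuous_const
  let e : OpenPartialHomeomorph E E :=
    { toFun := shrinkMap s
      invFun := fun y => (1 - s * ‖y‖)⁻¹ • y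
      source := Set.univ
      target := {y | s * ‖y‖ < 1}
      map_source' := fun x _ => shrinkMap_norm s hs x
      map_target' := fun _ _ => trivial
      left_inv' := by
        intro x _
        have h1 : 0 < 1 + s * ‖x‖ := by positivity
        have h2 : ‖shrinkMap s x‖ = (1 + s * ‖x‖)⁻¹ * ‖x‖ := by
          rw [shrinkMap, norm_smul, norm_inv, Real.norm_eq_abs, abs_of_pos h1]
        rw [h2, shrinkMap, smul_smul]
        have h3 : (1 - s * ((1 + s * ‖x‖)⁻¹ * ‖x‖)) = (1 + s * ‖x‖)⁻¹ := by
          field_simp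
          ring
        rw [h3, inv_inv, mul_inv_cancel₀ h1.ne', one_smul]
      right_inv' := by
        intro y hy
        have h1 : 0 < 1 - s * ‖y‖ := sub_pos.2 hy
        rw [shrinkMap, norm_smul, norm_inv, Real.norm_eq_abs, abs_of_pos h1, smul_smul]
        have h3 : (1 + s * ((1 - s * ‖y‖)⁻¹ * ‖y‖)) = (1 - s * ‖y‖)⁻¹ := by
          field_simp
          ring
        rw [h3, inv_inv, mul_inv_cancel₀ h1.ne', one_smul]
      open_source := isOpen_univ
      open_target := hopen
      continuousOn_toFun := (shrinkMap_continuous continuous_const continuous_id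
        (fun _ => hs)).continuousOn
      continuousOn_invFun := by
        refine ContinuousOn.smul (ContinuousOn.inv₀ (by fun_prop) ?_) continuousOn_id
        intro y hy
        exact (sub_pos.2 hy).ne' }
  exact e.isOpenEmbedding rfl

/-- The choice of shrinking parameter. -/
theorem exists_shrink_param [FiniteDimensional ℝ E] {X : Type*} [TopologicalSpace X]
    [CompactSpace X] [T2Space X] (D : Set X) (hD : IsClosed D) (W : Set (X × E)) (hW : IsOpen W)
    (hW0 : ∀ q, (q, (0 : E)) ∈ W) (hWD : ∀ q ∈ D, ∀ x, (q, x) ∈ W) :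
    ∃ s : X → ℝ, Continuous s ∧ (∀ q, 0 ≤ s q) ∧ (∀ q ∈ D, s q = 0) ∧
      ∀ q x, s q * ‖x‖ < 1 → (q, x) ∈ W := by
  have : ProperSpace E := FiniteDimensional.proper ℝ E
  have hV : ∀ k : ℕ, ∃ V : Set X, IsOpen V ∧ D ⊆ V ∧
      ∀ q ∈ V, ∀ x : E, ‖x‖ ≤ k → (q, x) ∈ W := by
    intro k
    obtain ⟨V, B, hVo, -, hDV, hB, hVB⟩ := generalized_tube_lemma hD.isCompact
      (isCompact_closedBall (0 : E) k) hW (fun z hz => hWD _ hz.1 _)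
    exact ⟨V, hVo, hDV, fun q hq x hx => hVB ⟨hq, hB (by simpa using hx)⟩⟩
  choose V hVo hDV hVW using hV
  obtain ⟨ε, hε, hεW⟩ : ∃ ε > 0, ∀ q, ∀ x : E, ‖x‖ < ε → (q, x) ∈ W := by
    obtain ⟨A, B, -, hBo, hA, hB, hAB⟩ := generalized_tube_lemma (isCompact_univ (X := X))
      (isCompact_singleton (x := (0 : E))) hW (by
        rintro ⟨q, x⟩ ⟨-, hx⟩
        have hx' : x = 0 := hx
        rw [hx']
        exact hW0 q)
    obtain ⟨ε, hε, hball⟩ := Metric.isOpen_iff.1 hBo 0 (hB rfl)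
    exact ⟨ε, hε, fun q x hx => hAB ⟨hA trivial, hball (by simpa using hx)⟩⟩
  have hf : ∀ k, ∃ f : C(X, ℝ), Set.EqOn f 0 D ∧ Set.EqOn f 1 (V k)ᶜ ∧
      ∀ x, f x ∈ Set.Icc (0 : ℝ) 1 := fun k =>
    exists_continuous_zero_one_of_isClosed hD (hVo k).isClosed_compl
      (Set.disjoint_left.2 fun q hq hq' => hq' (hDV k hq))
  choose f hf0 hf1 hfI using hf
  let w : ℕ → ℝ := fun k => 1 / ((k : ℝ) + 1) ^ 2
  have hw0 : ∀ k, 0 ≤ w k := fun k => by positivity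
  have hws : Summable w := by
    have := (summable_nat_add_iff (f := fun k : ℕ => 1 / (k : ℝ) ^ 2) 1).2
      (Real.summable_one_div_nat_pow.2 one_lt_two)
    simpa [w] using this
  have hbd : ∀ k q, ‖w k * f k q‖ ≤ w k := by
    intro k q
    have := hfI k q
    rw [Real.norm_eq_abs, abs_of_nonneg (mul_nonneg (hw0 k) this.1)]
    exact mul_le_of_le_one_right (hw0 k) this.2
  have hcont : Continuous (fun q => ∑' k, w k * f k q) :=
    continuous_tsum (fun k => continuous_const.mul (f k).continuous) hws hbd
  refine ⟨fun q => (1 + 2 / ε) * Real.sqrt (∑' k, w k * f k q),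
    continuous_const.mul hcont.sqrt, fun q => by positivity, ?_, ?_⟩
  · intro q hq
    have : ∀ k, w k * f k q = 0 := fun k => by
      have := hf0 k hq
      simp only [Pi.zero_apply] at this
      rw [this, mul_zero]
    simp [this]
  · intro q x
    contrapose!
    intro hqx
    have hxε : ε ≤ ‖x‖ := by
      by_contra h
      exact hqx (hεW q x (not_le.1 h))
    set k := ⌈‖x‖⌉₊
    have hxk : ‖x‖ ≤ k := Nat.le_ceil _
    have hkx : (k : ℝ) < ‖x‖ + 1 := Nat.ceil_lt_add_one (norm_nonneg _)
    have hqV : q ∈ (V k)ᶜ := fun h => hqx (hVW k q h x hxk)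
    have hfk : f k q = 1 := hf1 k hqV
    have hsum : Summable (fun k => w k * f k q) := Summable.of_norm_bounded hws (hbd · q)
    have h1 : w k * f k q ≤ ∑' k, w k * f k q :=
      hsum.le_tsum k (fun j _ => mul_nonneg (hw0 j) (hfI j q).1)
    rw [hfk, mul_one] at h1
    have h2 : 1 / ((k : ℝ) + 1) ≤ Real.sqrt (∑' k, w k * f k q) := by
      apply Real.le_sqrt_of_sq_le
      rw [div_pow, one_pow]
      exact h1
    have h3 : 1 / (‖x‖ + 2) ≤ Real.sqrt (∑' k, w k * f k q) := by
      refine le_trans ?_ h2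
      apply one_div_le_one_div_of_le (by positivity)
      linarith
    have hx0 : 0 < ‖x‖ := hε.trans_le hxε
    calc (1 : ℝ) = (‖x‖ + 2) * (1 / (‖x‖ + 2)) := by field_simp
      _ ≤ ((1 + 2 / ε) * ‖x‖) * Real.sqrt (∑' k, w k * f k q) := by
        apply mul_le_mul _ h3 (by positivity) (by positivity)
        have : 2 ≤ 2 / ε * ‖x‖ := by
          rw [div_mul_eq_mul_div, le_div_iff₀ hε]
          linarith
        linarith
      _ = _ := by ring

end shrink

theorem isClosed_cubeBoundary (m : ℕ) : IsClosed (cubeBoundary m) := by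
  have : cubeBoundary m = ⋃ i : Fin m, ({q | q i = 0} ∪ {q | q i = 1}) := by
    ext q
    simp [cubeBoundary]
  rw [this]
  refine isClosed_iUnion_of_finite fun i => IsClosed.union ?_ ?_
  · exact isClosed_eq (continuous_apply i) continuous_const
  · exact isClosed_eq (continuous_apply i) continuous_const

/-- A jointly continuous family of open embeddings gives a continuous map to `EmbSp`. -/
noncomputable def embFamily {Y : Type*} [TopologicalSpace Y] (n : ℕ) {S M : Type*}
    [TopologicalSpace S] [TopologicalSpace M] (F : Y → EuclideanSpace ℝ (Fin n) × S → M)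
    (hF : Continuous (fun z : Y × (EuclideanSpace ℝ (Fin n) × S) => F z.1 z.2))
    (he : ∀ y, IsOpenEmbedding (F y)) : C(Y, EmbSp n S M) :=
  ⟨fun y => ⟨⟨F y, (he y).continuous⟩, he y⟩, by
    apply Continuous.subtype_mk
    exact (ContinuousMap.curry ⟨_, hF⟩).continuous⟩

theorem continuous_evalEmb {n : ℕ} {S M : Type*} [TopologicalSpace S] [DiscreteTopology S]
    [TopologicalSpace M] :
    Continuous (fun z : EmbSp n S M × (EuclideanSpace ℝ (Fin n) × S) => z.1.1 z.2) := by
  have h : Continuous (fun z : C(EuclideanSpace ℝ (Fin n) × S, M) ×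
      (EuclideanSpace ℝ (Fin n) × S) => z.1 z.2) := by fun_prop
  exact h.comp ((continuous_subtype_val.comp continuous_fst).prodMk continuous_snd)

/-- Let `M` be an `n`-manifold, `S` a finite set of cardinality `k`,
`U ⊆ M` an open set homeomorphic to a disjoint union of `k` copies of `ℝⁿ`, and
`φ : U → M` an (open) embedding.  Then the square formed by postcomposition with `φ`
(horizontally) and evaluation at the origins (vertically) is homotopy cartesian in the
Quillen model structure on topological spaces. -/
theorem statement4 (n k : ℕ) (M : Type*) [TopologicalSpace M]
    [ChartedSpace (EuclideanSpace ℝ (Fin n)) M] [T2Space M] [SecondCountableTopology M]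
    (S : Type*) [Fintype S] [TopologicalSpace S] [DiscreteTopology S]
    (hS : Fintype.card S = k)
    (U : Set M) (hUopen : IsOpen U)
    (hU : Nonempty (U ≃ₜ EuclideanSpace ℝ (Fin n) × Fin k))
    (φ : C(U, M)) (hφ : IsOpenEmbedding φ) :
    IsHomotopyCartesian
      (embPostcomp n S U M φ hφ) (evalOriginsMap n S U)
      (evalOriginsMap n S M) (confPostcomp S U M φ hφ)
      (fun e => rfl) := by
  refine ⟨?_, ?_⟩
  · apply Continuous.subtype_mk
    refine (embPostcomp n S U M φ hφ).continuous.prodMk (Continuous.prodMk ?_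
      (evalOriginsMap n S U).continuous)
    exact ContinuousMap.continuous_const'.comp
      ((evalOriginsMap n S M).continuous.comp (embPostcomp n S U M φ hφ).continuous)
  intro m α β hβ
  -- the components of `β`
  have hβv : Continuous (fun q => (β q).1) := continuous_subtype_val.comp β.continuous
  let e : (Fin m → unitInterval) → EmbSp n S M := fun q => (β q).1.1
  let γ : (Fin m → unitInterval) → C(unitInterval, ConfSp S M) := fun q => (β q).1.2.1
  let c : (Fin m → unitInterval) → ConfSp S U := fun q => (β q).1.2.2
  have he : Continuous e := continuous_fst.comp hβv
  have hγ : Continuous γ := continuous_fst.comp (continuous_snd.comp hβv)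
  have hc : Continuous c := continuous_snd.comp (continuous_snd.comp hβv)
  have hγ0 : ∀ q, γ q 0 = evalOriginsMap n S M (e q) := fun q => (β q).2.1
  have hγ1 : ∀ q, γ q 1 = confPostcomp S U M φ hφ (c q) := fun q => (β q).2.2
  have hγev : Continuous (fun z : (Fin m → unitInterval) × unitInterval => γ z.1 z.2) := by
    have h1 : Continuous (fun z : C(unitInterval, ConfSp S M) × unitInterval => z.1 z.2) := by
      fun_prop
    exact h1.comp ((hγ.comp continuous_fst).prodMk continuous_snd)
  have hbe : ∀ q (hq : q ∈ cubeBoundary m), e q = embPostcomp n S U M φ hφ (α ⟨q, hq⟩) := by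
    intro q hq
    have := hβ ⟨q, hq⟩
    exact congrArg (fun z => z.1.1) this
  have hbγ : ∀ q (hq : q ∈ cubeBoundary m) u, γ q u =
      evalOriginsMap n S M (embPostcomp n S U M φ hφ (α ⟨q, hq⟩)) := by
    intro q hq u
    have := hβ ⟨q, hq⟩
    exact congrArg (fun z => z.1.2.1 u) this
  -- lifting the homotopy
  let Γ : ((Fin m → unitInterval) × unitInterval) × ℝ → ConfSp S M := fun z =>
    γ z.1.1 (z.1.2 * Set.projIcc 0 1 zero_le_one z.2)
  have hΓ : Continuous Γ := by
    refine hγev.comp (f := fun z : ((Fin m → unitInterval) × unitInterval) × ℝ =>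
      (z.1.1, z.1.2 * Set.projIcc 0 1 zero_le_one z.2)) ?_
    refine Continuous.prodMk (by fun_prop) (Continuous.mul (by fun_prop) ?_)
    exact continuous_projIcc.comp continuous_snd
  have hΓ0 : ∀ y, Γ (y, 0) = γ y.1 0 := by
    intro y
    change γ y.1 (y.2 * Set.projIcc 0 1 zero_le_one 0) = _
    rw [Set.projIcc_left]
    congr 1
    exact mul_zero _
  have hΓ1 : ∀ y, Γ (y, 1) = γ y.1 y.2 := by
    intro y
    change γ y.1 (y.2 * Set.projIcc 0 1 zero_le_one 1) = _
    rw [Set.projIcc_right]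
    congr 1
    exact mul_one _
  let K : Set ((Fin m → unitInterval) × unitInterval) := {y | y.1 ∈ cubeBoundary m ∨ y.2 = 0}
  have hK : ∀ y ∈ K, ∀ u u', Γ (y, u) = Γ (y, u') := by
    rintro ⟨q, t⟩ hy u u'
    rcases hy with hy | hy
    · exact (hbγ q hy _).trans (hbγ q hy _).symm
    · change t = 0 at hy
      subst hy
      change γ q (0 * _) = γ q (0 * _)
      rw [zero_mul, zero_mul]
  obtain ⟨F, hF, hFe, hF0, hFK⟩ := lift_homotopy n M S Γ hΓ (fun y => (e y.1).1) K hK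
    ⟨fun y => (e y.1).1, continuous_evalEmb.comp (f := fun z :
        ((Fin m → unitInterval) × unitInterval) × (EuclideanSpace ℝ (Fin n) × S) =>
        (e z.1.1, z.2)) ((he.comp (by fun_prop)).prodMk (by fun_prop)),
      fun y => (e y.1).2, fun y s =>
        (congrArg (fun z : ConfSp S M => z.1 s) ((hΓ0 y).trans (hγ0 y.1))).symm, fun y _ => rfl⟩
  have hF0' : ∀ q t s, F (q, t) (0, s) = (γ q t).1 s := by
    intro q t s
    exact (hF0 (q, t) s).trans (congrArg (fun z : ConfSp S M => z.1 s) (hΓ1 (q, t)))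
  -- shrinking parameter
  let W : Set ((Fin m → unitInterval) × EuclideanSpace ℝ (Fin n)) :=
    {z | ∀ j, F (z.1, 1) (z.2, j) ∈ Set.range φ}
  have hW : IsOpen W := by
    have : W = ⋂ j, (fun z : (Fin m → unitInterval) × EuclideanSpace ℝ (Fin n) =>
        F (z.1, 1) (z.2, j)) ⁻¹' Set.range φ := by
      ext z
      simp [W]
    rw [this]
    refine isOpen_iInter_of_finite fun j => hφ.isOpen_range.preimage ?_
    exact hF.comp (f := fun z : (Fin m → unitInterval) × EuclideanSpace ℝ (Fin n) =>
      ((z.1, (1 : unitInterval)), (z.2, j))) (by fun_prop)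
  obtain ⟨s, hs, hs0, hsD, hsW⟩ := exists_shrink_param (cubeBoundary m)
    (isClosed_cubeBoundary m) W hW (fun q j => by
      change F (q, 1) (0, j) ∈ _
      rw [hF0', hγ1]
      exact ⟨(c q).1 j, rfl⟩) (fun q hq x j => by
      change F (q, 1) (x, j) ∈ _
      rw [hFK (q, 1) (Or.inl hq)]
      change (e q).1 (x, j) ∈ _
      rw [hbe q hq]
      exact ⟨(α ⟨q, hq⟩).1 (x, j), rfl⟩)
  -- shrunk family
  have hshr : ∀ r : ℝ, 0 ≤ r → IsOpenEmbedding
      (fun p : EuclideanSpace ℝ (Fin n) × S => (shrinkMap r p.1, p.2)) := fun r hr =>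
    (shrinkMap_isOpenEmbedding r hr).prodMap IsOpenEmbedding.id
  let G : (Fin m → unitInterval) × unitInterval → EuclideanSpace ℝ (Fin n) × S → M :=
    fun z p => F (z.1, unitInterval.symm z.2)
      (shrinkMap ((unitInterval.symm z.2 : ℝ) * s z.1) p.1, p.2)
  have hr0 : ∀ z : (Fin m → unitInterval) × unitInterval,
      0 ≤ (unitInterval.symm z.2 : ℝ) * s z.1 := fun z =>
    mul_nonneg (unitInterval.symm z.2).2.1 (hs0 _)
  have hG : Continuous (fun z : ((Fin m → unitInterval) × unitInterval) ×
      (EuclideanSpace ℝ (Fin n) × S) => G z.1 z.2) := by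
    refine hF.comp (f := fun z : ((Fin m → unitInterval) × unitInterval) ×
      (EuclideanSpace ℝ (Fin n) × S) => ((z.1.1, unitInterval.symm z.1.2),
      (shrinkMap ((unitInterval.symm z.1.2 : ℝ) * s z.1.1) z.2.1, z.2.2))) ?_
    refine Continuous.prodMk (by fun_prop) (Continuous.prodMk ?_ (by fun_prop))
    exact shrinkMap_continuous (by fun_prop) (by fun_prop) (fun z => hr0 z.1)
  have hGe : ∀ z, IsOpenEmbedding (G z) := fun z => (hFe _).comp (hshr _ (hr0 z))
  have hGU : ∀ q p, G (q, 0) p ∈ Set.range φ := by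
    intro q p
    have : (q, shrinkMap (s q) p.1) ∈ W := hsW _ _ (shrinkMap_norm _ (hs0 q) _)
    have h2 := this p.2
    simpa [G] using h2
  choose L hL using hGU
  have hLc : Continuous (fun z : (Fin m → unitInterval) × (EuclideanSpace ℝ (Fin n) × S) =>
      L z.1 z.2) := by
    rw [hφ.isInducing.continuous_iff]
    have : φ ∘ (fun z : (Fin m → unitInterval) × (EuclideanSpace ℝ (Fin n) × S) =>
      L z.1 z.2) = fun z => G (z.1, 0) z.2 := funext fun z => hL _ _
    rw [this]
    exact hG.comp (f := fun z : (Fin m → unitInterval) × (EuclideanSpace ℝ (Fin n) × S) =>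
      ((z.1, (0 : unitInterval)), z.2)) (by fun_prop)
  have hLe : ∀ q, IsOpenEmbedding (L q) := by
    intro q
    apply IsOpenEmbedding.of_comp _ hφ
    have : φ ∘ L q = G (q, 0) := funext fun p => hL q p
    rw [this]
    exact hGe _
  have hGb : ∀ q ∈ cubeBoundary m, ∀ t, G (q, t) = (e q).1 := by
    intro q hq t
    funext p
    change F (q, unitInterval.symm t) (shrinkMap ((unitInterval.symm t : ℝ) * s q) p.1, p.2) = _
    rw [hsD q hq, mul_zero, shrinkMap_zero_left, hFK _ (Or.inl hq)]
  refine ⟨embFamily n L hLc hLe, ?_, ?_⟩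
  · rintro ⟨q, hq⟩
    apply Subtype.ext
    ext p : 1
    apply hφ.injective
    change φ (L q p) = _
    rw [hL, hGb q hq, hbe q hq]
    rfl
  -- the homotopy
  let P : C(((Fin m → unitInterval) × unitInterval) × unitInterval, ConfSp S M) :=
    ⟨fun z => γ z.1.1 (max z.2 (unitInterval.symm z.1.2)),
      hγev.comp (f := fun z : ((Fin m → unitInterval) × unitInterval) × unitInterval =>
        (z.1.1, max z.2 (unitInterval.symm z.1.2))) (by fun_prop)⟩
  have hP0 : ∀ z, P.curry z 0 = evalOriginsMap n S M (embFamily n G hG hGe z) := by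
    intro z
    apply Subtype.ext
    funext j
    change (γ z.1 (max 0 (unitInterval.symm z.2))).1 j =
      F (z.1, unitInterval.symm z.2) (shrinkMap _ 0, j)
    rw [shrinkMap_zero_right, hF0', max_eq_right (unitInterval.nonneg')]
  have hP1 : ∀ z, P.curry z 1 = confPostcomp S U M φ hφ (c z.1) := by
    intro z
    rw [← hγ1]
    change γ z.1 (max 1 (unitInterval.symm z.2)) = _
    rw [max_eq_left (unitInterval.le_one')]
  refine ⟨⟨fun z => ⟨(embFamily n G hG hGe z, P.curry z, c z.1), hP0 z, hP1 z⟩, ?_⟩, ?_, ?_, ?_⟩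
  · apply Continuous.subtype_mk
    exact (embFamily n G hG hGe).continuous.prodMk
      (P.curry.continuous.prodMk (hc.comp continuous_fst))
  · intro q
    have h1 : embFamily n G hG hGe (q, 0) =
        embPostcomp n S U M φ hφ (embFamily n L hLc hLe q) := by
      apply Subtype.ext
      ext p : 1
      exact (hL q p).symm
    have h2 : P.curry (q, 0) = ContinuousMap.const unitInterval (evalOriginsMap n S M
        (embPostcomp n S U M φ hφ (embFamily n L hLc hLe q))) := by
      ext u : 1
      rw [← h1, ← hP0]
      change γ q (max u (unitInterval.symm 0)) = γ q (max 0 (unitInterval.symm 0))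
      rw [unitInterval.symm_zero, max_eq_right unitInterval.le_one',
        max_eq_right unitInterval.le_one']
    have h3 : c q = evalOriginsMap n S U (embFamily n L hLc hLe q) := by
      apply Subtype.ext
      funext j
      apply hφ.injective
      change φ ((c q).1 j) = φ (L q (0, j))
      rw [hL]
      have h4 := hP0 (q, 0)
      have h5 : P.curry (q, 0) 0 = γ q 1 := by
        change γ q (max 0 (unitInterval.symm 0)) = _
        rw [unitInterval.symm_zero, max_eq_right unitInterval.le_one']
      rw [h5, hγ1] at h4
      exact congrArg (fun z => z.1 j) h4
    apply Subtype.ext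
    exact Prod.ext h1 (Prod.ext h2 h3)
  · intro q
    apply Subtype.ext
    refine Prod.ext ?_ (Prod.ext ?_ rfl)
    · apply Subtype.ext
      ext p : 1
      change F (q, unitInterval.symm 1) (shrinkMap ((unitInterval.symm 1 : ℝ) * s q) p.1, p.2) = _
      rw [unitInterval.symm_one, hFK (q, 0) (Or.inr rfl)]
      simp only [Set.Icc.coe_zero, zero_mul, shrinkMap_zero_left]
      rfl
    · ext u : 1
      change γ q (max u (unitInterval.symm 1)) = γ q u
      rw [unitInterval.symm_one, max_eq_left unitInterval.nonneg']
  · rintro ⟨q, hq⟩ t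
    apply Subtype.ext
    refine Prod.ext ?_ (Prod.ext ?_ rfl)
    · apply Subtype.ext
      ext p : 1
      change G (q, t) p = _
      rw [hGb q hq]
    · ext u : 1
      exact (hbγ q hq _).trans (hbγ q hq _).symm
end

section
/- Let n ≥ 0. The simplicial monoid Germ₀(ℝⁿ) of germs at the origin of self-embeddings of ℝⁿ fixing the origin is a simplicial group: every simplex has a two-sided inverse under germ composition. -/
open Metric

/-- A representative of a `k`-simplex of the simplicial monoid `Germ₀(ℝⁿ)`: a
continuous family, parametrized by the topological `k`-simplex, of embeddings of a
small ball `Bⁿ(r)` into `ℝⁿ` fixing the origin.  (The germ is the equivalence class of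
such data under restriction to smaller balls.) -/
structure GermZeroRep (n k : ℕ) where
  r : ℝ
  r_pos : 0 < r
  σ : (Fin (k + 1) → ℝ) → EuclideanSpace ℝ (Fin n) → EuclideanSpace ℝ (Fin n)
  cont : ContinuousOn (fun p : (Fin (k + 1) → ℝ) × EuclideanSpace ℝ (Fin n) => σ p.1 p.2)
    ((stdSimplex ℝ (Fin (k + 1))) ×ˢ ball (0 : EuclideanSpace ℝ (Fin n)) r)
  inj : ∀ x ∈ stdSimplex ℝ (Fin (k + 1)), Set.InjOn (σ x) (ball (0 : EuclideanSpace ℝ (Fin n)) r)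
  fix : ∀ x ∈ stdSimplex ℝ (Fin (k + 1)), σ x 0 = 0


section Aux

open Set MeasureTheory Filter Topology


theorem glue_lip {E : Type*} [NormedAddCommGroup E] [NormedSpace ℝ E] {L : NNReal} {w : E → E}
    (hw : LipschitzOnWith L w (closedBall 0 2)) (h0 : ∀ x, ‖x‖ = 2 → w x = 0) :
    LipschitzWith L (fun x => if ‖x‖ ≤ 2 then w x else 0) := by
  have key : ∀ x y : E, ‖x‖ ≤ 2 → ¬ ‖y‖ ≤ 2 → dist (w x) 0 ≤ L * dist x y := by
    intro x y hx hy
    push Not at hy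
    have hc : Continuous fun t : ℝ => ‖AffineMap.lineMap x y t‖ :=
      (AffineMap.lineMap_continuous).norm
    have := intermediate_value_Icc (zero_le_one' ℝ) hc.continuousOn
    obtain ⟨t, ht, hz⟩ := this (show (2:ℝ) ∈ _ by simp; exact ⟨hx, hy.le⟩)
    set z := AffineMap.lineMap x y t
    have hz' : ‖z‖ = 2 := hz
    rw [← h0 z hz']
    refine (hw.dist_le_mul x (by simpa using hx) z (by simp [hz'])).trans ?_
    gcongr
    rw [dist_left_lineMap, Real.norm_eq_abs, abs_of_nonneg ht.1]
    exact mul_le_of_le_one_left dist_nonneg ht.2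
  refine LipschitzWith.of_dist_le_mul fun x y => ?_
  by_cases hx : ‖x‖ ≤ 2 <;> by_cases hy : ‖y‖ ≤ 2 <;> simp only [hx, hy, if_true, if_false]
  · exact hw.dist_le_mul x (by simpa using hx) y (by simpa using hy)
  · exact key x y hx hy
  · rw [dist_comm, dist_comm x]; exact key y x hy hx
  · simp; positivity

theorem det_interp {E : Type*} [NormedAddCommGroup E] [NormedSpace ℝ E] [FiniteDimensional ℝ E]
    (t : ℕ → ℝ) (ht : Function.Injective t) :
    ∃ (N : ℕ) (c : ℕ → ℝ), (∑ j ∈ Finset.range N, c j = 1) ∧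
      ∀ A : E →L[ℝ] E, (1 + A).det = ∑ j ∈ Finset.range N, c j * (1 + t j • A).det := by
  let N := Module.finrank ℝ E + 1
  let c : ℕ → ℝ := fun j => (Lagrange.basis (Finset.range N) t j).eval 1
  refine ⟨N, c, ?_, fun A => ?_⟩
  · have := Lagrange.sum_basis (s := Finset.range N) (v := t) ht.injOn (by simp [N])
    have := congrArg (Polynomial.eval 1) this
    simpa [Polynomial.eval_finsetSum] using this
  · let b := Module.finBasis ℝ E
    let M := LinearMap.toMatrix b b (A : E →ₗ[ℝ] E)
    let p : Polynomial ℝ := ((Polynomial.X : Polynomial ℝ) • M.map Polynomial.C + (1 : Matrix _ _ ℝ).map Polynomial.C).det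
    have hp : ∀ s : ℝ, (1 + s • A).det = p.eval s := by
      intro s
      rw [ContinuousLinearMap.det, ← LinearMap.det_toMatrix b]
      simp only [p]
      rw [← Polynomial.coe_evalRingHom, RingHom.map_det]
      congr 1
      ext i j
      simp [M, Matrix.one_apply, LinearMap.toMatrix_apply, Finsupp.single_apply, apply_ite, eq_comm]
      split_ifs <;> ring
    have hdeg : p.degree < (Finset.range N).card := by
      have := Polynomial.natDegree_det_X_add_C_le M 1
      refine lt_of_le_of_lt (Polynomial.degree_le_of_natDegree_le this) ?_
      simp [N]
      exact_mod_cast Nat.lt_succ_self _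
    have h1 := Lagrange.eq_interpolate (s := Finset.range N) (v := t) ht.injOn hdeg
    have h2 := congrArg (Polynomial.eval 1) h1
    have h3 := hp 1
    rw [one_smul] at h3
    rw [h3, h2]
    simp only [Lagrange.interpolate_apply, Polynomial.eval_finsetSum, Polynomial.eval_mul, Polynomial.eval_C, hp, c]
    exact Finset.sum_congr rfl fun _ _ => mul_comm _ _

theorem image_small {E : Type*} [NormedAddCommGroup E] [NormedSpace ℝ E] [CompleteSpace E]
    [Nontrivial E] {L : NNReal} {v : E → E} (hv : LipschitzWith L v) (h0 : ∀ x, 2 ≤ ‖x‖ → v x = 0)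
    (hL : L < 1) :
    Function.Injective (fun x => x + v x) ∧ (fun x => x + v x) '' ball 0 2 = ball 0 2 := by
  have ha : ApproximatesLinearOn (fun x => x + v x)
      ((ContinuousLinearEquiv.refl ℝ E : E ≃L[ℝ] E) : E →L[ℝ] E) univ L := by
    intro x _ y _
    have : x + v x - (y + v y) - (x - y) = v x - v y := by abel
    simpa [this, dist_eq_norm] using hv.dist_le_mul x y
  have hc : Subsingleton E ∨ L < ‖(((ContinuousLinearEquiv.refl ℝ E).symm : E ≃L[ℝ] E) : E →L[ℝ] E)‖₊⁻¹ := by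
    right
    simpa using hL
  have hinj : Function.Injective (fun x => x + v x) := by
    have := ha.injOn hc
    rwa [injOn_univ] at this
  have hsurj := ha.surjective hc
  refine ⟨hinj, ?_⟩
  have hfix : ∀ x, 2 ≤ ‖x‖ → (fun x => x + v x) x = x := fun x hx => by simp [h0 x hx]
  ext y
  constructor
  · rintro ⟨x, hx, rfl⟩
    by_contra hy
    have hy' : 2 ≤ ‖x + v x‖ := by simpa using hy
    have := hinj (hfix _ hy')
    simp only at this
    rw [this] at hy'
    simp at hx
    linarith
  · intro hy
    obtain ⟨x, rfl⟩ := hsurj y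
    refine ⟨x, ?_, rfl⟩
    by_contra hx
    have hx' : 2 ≤ ‖x‖ := by simpa using hx
    have := hfix _ hx'
    rw [this] at hy
    exact hx hy

theorem int_det {E : Type*} [NormedAddCommGroup E] [NormedSpace ℝ E] [FiniteDimensional ℝ E]
    [Nontrivial E] [MeasurableSpace E] [BorelSpace E] (μ : Measure E) [μ.IsAddHaarMeasure]
    (w : E → E) (hw : ContDiff ℝ 1 w) (h0 : ∀ x, ‖x‖ = 2 → w x = 0) :
    ∫ x in ball (0 : E) 2, (1 + fderiv ℝ w x).det ∂μ = μ.real (ball 0 2) := by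
  have : CompleteSpace E := FiniteDimensional.complete ℝ E
  have hdc : Continuous (fderiv ℝ w) := hw.continuous_fderiv one_ne_zero
  obtain ⟨C, hC⟩ := (isCompact_closedBall (0 : E) 2).exists_bound_of_continuousOn hdc.continuousOn
  have hC0 : 0 ≤ C := (norm_nonneg _).trans (hC 0 (by simp))
  lift C to NNReal using hC0
  have hlip : LipschitzOnWith C w (closedBall 0 2) :=
    (convex_closedBall (0 : E) 2).lipschitzOnWith_of_nnnorm_fderiv_le
      (fun x _ => hw.differentiable one_ne_zero x) (fun x hx => hC x hx)
  have hg := glue_lip hlip h0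
  set w' : E → E := fun x => if ‖x‖ ≤ 2 then w x else 0 with hw'
  have hdet : ∃ δ > 0, ∀ B : E →L[ℝ] E, ‖B‖ < δ → 0 < (1 + B).det := by
    have hcont : Continuous fun B : E →L[ℝ] E => (1 + B).det :=
      ContinuousLinearMap.continuous_det.comp (continuous_const.add continuous_id)
    have h1 : (0 : ℝ) < (1 + (0 : E →L[ℝ] E)).det := by
      simp [ContinuousLinearMap.det]
    obtain ⟨δ, hδ, h⟩ := Metric.mem_nhds_iff.1 ((hcont.isOpen_preimage _ isOpen_Ioi).mem_nhds
      (show (0 : E →L[ℝ] E) ∈ _ ⁻¹' Ioi (0 : ℝ) from h1))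
    exact ⟨δ, hδ, fun B hB => h (by simpa using hB)⟩
  obtain ⟨δ, hδ, hdet⟩ := hdet
  have small : ∀ t : ℝ, 0 < t → t * C < 1 → t * C < δ →
      ∫ x in ball (0 : E) 2, (1 + t • fderiv ℝ w x).det ∂μ = μ.real (ball 0 2) := by
    intro t ht h1 h2
    lift t to NNReal using ht.le
    have hv : LipschitzWith (t * C) (fun x => (t : ℝ) • w' x) := by
      refine LipschitzWith.of_dist_le_mul fun x y => ?_
      rw [dist_smul₀]
      have := hg.dist_le_mul x y
      simp only [NNReal.coe_mul, mul_assoc, Real.norm_eq_abs, NNReal.abs_eq]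
      gcongr
    obtain ⟨hi, him⟩ := image_small hv (fun x hx => by
      by_cases h : ‖x‖ ≤ 2
      · simp [hw', h0 x (le_antisymm h hx)]
      · simp [hw', h]) (by exact_mod_cast h1)
    have hder : ∀ x ∈ ball (0 : E) 2, HasFDerivWithinAt (fun x => x + (t : ℝ) • w' x)
        (1 + (t : ℝ) • fderiv ℝ w x) (ball 0 2) x := by
      intro x hx
      have hd : HasFDerivWithinAt (fun x => x + (t : ℝ) • w x)
        (1 + (t : ℝ) • fderiv ℝ w x) (ball 0 2) x :=
        ((hasFDerivAt_id x).add
          ((hw.differentiable one_ne_zero x).hasFDerivAt.const_smul (t : ℝ))).hasFDerivWithinAt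
      have hE : ∀ y ∈ ball (0 : E) 2, y + (t : ℝ) • w' y = y + (t : ℝ) • w y := by
        intro y hy
        have : ‖y‖ ≤ 2 := by simpa using (ball_subset_closedBall hy)
        simp [hw', this]
      exact hd.congr hE (hE x hx)
    have hch := integral_image_eq_integral_abs_det_fderiv_smul μ measurableSet_ball hder hi.injOn
      (fun _ => (1 : ℝ))
    rw [him] at hch
    have e1 : ∫ x in ball (0 : E) 2, (1 : ℝ) ∂μ = μ.real (ball 0 2) := by simp
    rw [← e1, hch]
    refine setIntegral_congr_fun measurableSet_ball fun x hx => ?_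
    have hpos : 0 < (1 + (t : ℝ) • fderiv ℝ w x).det := by
      apply hdet
      rw [norm_smul]
      refine lt_of_le_of_lt ?_ h2
      simp only [Real.norm_eq_abs, NNReal.abs_eq]
      gcongr
      exact hC x (ball_subset_closedBall hx)
    simp [abs_of_pos hpos]
  let a : ℝ := min δ 1 / (2 * (C + 1))
  have ha : 0 < a := by positivity
  have haC : a * C < min δ 1 := by
    have : 0 < min δ 1 := by positivity
    simp only [a]
    rw [div_mul_eq_mul_div, div_lt_iff₀ (by positivity)]
    have : (0:ℝ) ≤ C := C.2
    nlinarith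
  obtain ⟨N, c, hc1, hc⟩ := det_interp (E := E) (fun j => a / (j + 1)) (by
    intro i j h
    simp only at h
    have hi : (i : ℝ) + 1 ≠ 0 := by positivity
    have hj : (j : ℝ) + 1 ≠ 0 := by positivity
    rw [div_eq_div_iff hi hj] at h
    have := mul_left_cancel₀ ha.ne' h
    have : (i : ℝ) = j := by linarith
    exact_mod_cast this)
  have hsm : ∀ j : ℕ, ∫ x in ball (0 : E) 2, (1 + (a / (j + 1)) • fderiv ℝ w x).det ∂μ
      = μ.real (ball 0 2) := by
    intro j
    have hle : a / (j + 1) ≤ a := div_le_self ha.le (by simp)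
    have : a / (j+1) * C < min δ 1 := lt_of_le_of_lt (by gcongr) haC
    exact small _ (by positivity) (this.trans_le (min_le_right _ _)) (this.trans_le (min_le_left _ _))
  rw [setIntegral_congr_fun measurableSet_ball (fun x _ => hc (fderiv ℝ w x))]
  rw [integral_finsetSum]
  · simp_rw [integral_const_mul, hsm, ← Finset.sum_mul, hc1, one_mul]
  · intro j _
    apply Integrable.const_mul
    have : Continuous fun x => (1 + (a / (j + 1)) • fderiv ℝ w x).det :=
      ContinuousLinearMap.continuous_det.comp (continuous_const.add (show Continuous fun x => (a / (j + 1)) • fderiv ℝ w x from hdc.const_smul (a / (j + 1))))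
    exact (this.continuousOn.integrableOn_compact (isCompact_closedBall (0:E) 2)).mono_set
      ball_subset_closedBall

theorem smooth_zero {E : Type*} [NormedAddCommGroup E] [InnerProductSpace ℝ E]
    [FiniteDimensional ℝ E] [Nontrivial E] (h : E → E) (hh : ContDiff ℝ 1 h)
    (h0 : ∀ x, 1 ≤ ‖x‖ → h x = 0) : ∃ x, x + h x = 0 := by
  by_contra hne
  push Not at hne
  borelize E
  let μ : Measure E := Measure.addHaar
  let F : E → E := fun x => x + h x
  have hF : ContDiff ℝ 1 F := contDiff_id.add hh
  let G : E → E := fun x => (2 / ‖F x‖) • F x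
  have hG : ContDiff ℝ 1 G := by
    have : ContDiff ℝ 1 fun x => ‖F x‖ := hF.norm ℝ hne
    exact (contDiff_const.div this fun x => norm_ne_zero_iff.2 (hne x)).smul hF
  have hGn : ∀ x, ‖G x‖ = 2 := by
    intro x
    have : ‖F x‖ ≠ 0 := norm_ne_zero_iff.2 (hne x)
    simp only [G, norm_smul, norm_div, norm_norm, Real.norm_ofNat]
    field_simp
  have key := int_det μ (fun x => G x - x) (hG.sub contDiff_id) (by
    intro x hx
    have : F x = x := by simp [F, h0 x (by linarith)]
    simp [G, this, hx])
  have hz : ∀ x, (1 + fderiv ℝ (fun x => G x - x) x).det = 0 := by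
    intro x
    have hGd := (hG.differentiable one_ne_zero x).hasFDerivAt
    have e : fderiv ℝ (fun x => G x - x) x = fderiv ℝ G x - 1 :=
      (hGd.sub (hasFDerivAt_id x)).fderiv
    rw [e, add_sub_cancel]
    by_contra hd
    have hu : IsUnit (fderiv ℝ G x : E →ₗ[ℝ] E) :=
      (LinearMap.isUnit_iff_isUnit_det _).2 (isUnit_iff_ne_zero.2 hd)
    have hs := ((Module.End.isUnit_iff _).1 hu).2
    obtain ⟨v, hv⟩ := hs (G x)
    have h1 := (hGd.inner ℝ hGd)
    have h2 : (fun t => inner ℝ (G t) (G t)) = fun _ => (4 : ℝ) := by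
      funext t
      rw [real_inner_self_eq_norm_sq, hGn]; norm_num
    rw [h2] at h1
    have h3 := h1.unique (hasFDerivAt_const (4 : ℝ) x)
    have h4 := congrArg (fun A => A v) h3
    have hv' : fderiv ℝ G x v = G x := hv
    simp [fderivInnerCLM_apply, hv', hGn] at h4
  simp [hz] at key
  have : 0 < μ.real (ball (0:E) 2) := by
    exact ENNReal.toReal_pos (measure_ball_pos μ _ two_pos).ne' measure_ball_lt_top.ne
  linarith

theorem brouwer_zero {E : Type*} [NormedAddCommGroup E] [InnerProductSpace ℝ E]
    [FiniteDimensional ℝ E] [Nontrivial E] (u : E → E) (hu : Continuous u)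
    (hb : ∀ x, ‖x‖ ≤ 1 → ‖u x‖ ≤ 1 / 2) : ∃ x, ‖x‖ ≤ 1 ∧ x + u x = 0 := by
  by_contra hne
  push Not at hne
  have hcont : ContinuousOn (fun x => ‖x + u x‖) (closedBall (0 : E) 1) := by fun_prop
  obtain ⟨x₀, hx₀, hmin⟩ := (isCompact_closedBall (0 : E) 1).exists_isMinOn ⟨0, by simp⟩ hcont
  have hpos : 0 < ‖x₀ + u x₀‖ := norm_pos_iff.2 (hne _ (by simpa using hx₀))
  set m := ‖x₀ + u x₀‖
  obtain ⟨g, hg, hgu, -⟩ := hu.exists_contDiff_approx 1 (ε := fun _ => min m (1/4))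
    continuous_const (fun _ => by positivity)
  let χ : ContDiffBump (0 : E) := ⟨7/8, 1, by norm_num, by norm_num⟩
  obtain ⟨x, hx⟩ := smooth_zero (fun x => χ x • g x) (χ.contDiff.smul hg) (by
    intro x hx
    have : χ x = 0 := χ.zero_of_le_dist (by simpa using hx)
    simp [this])
  have hx1 : ‖x‖ ≤ 1 := by
    by_contra hc
    have : χ x = 0 := χ.zero_of_le_dist (by simpa using (not_le.1 hc).le)
    simp [this] at hx
    simp [hx] at hc
  have hd := hgu x
  rw [dist_eq_norm] at hd
  by_cases hx7 : ‖x‖ ≤ 7/8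
  · have : χ x = 1 := χ.one_of_mem_closedBall (by simpa using hx7)
    simp only [this, one_smul] at hx
    have h1 : m ≤ ‖x + u x‖ := hmin (by simpa using hx1)
    have h2 : x + u x = -(g x - u x) := by
      calc x + u x = (x + g x) - (g x - u x) := by abel
        _ = _ := by rw [hx, zero_sub]
    rw [h2, norm_neg] at h1
    exact absurd (hd.trans_le (min_le_left _ _)) (not_lt.2 h1)
  · have h1 : ‖x‖ = ‖χ x • g x‖ := by rw [eq_neg_of_add_eq_zero_right hx, norm_neg]
    have h2 : ‖χ x • g x‖ ≤ ‖g x‖ := by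
      rw [norm_smul, Real.norm_eq_abs, abs_of_nonneg χ.nonneg]
      exact mul_le_of_le_one_left (norm_nonneg _) χ.le_one
    have h3 : ‖g x‖ ≤ ‖g x - u x‖ + ‖u x‖ := by simpa using norm_add_le (g x - u x) (u x)
    have h4 := hd.trans_le (min_le_right _ _)
    have h5 := hb x hx1
    linarith

theorem brouwer_zero_on {E : Type*} [NormedAddCommGroup E] [InnerProductSpace ℝ E]
    [FiniteDimensional ℝ E] [Nontrivial E] (u : E → E) (hu : ContinuousOn u (closedBall 0 1))
    (hb : ∀ x, ‖x‖ ≤ 1 → ‖u x‖ ≤ 1 / 2) : ∃ x, ‖x‖ ≤ 1 ∧ x + u x = 0 := by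
  obtain ⟨g, hg⟩ := ContinuousMap.exists_restrict_eq (isClosed_closedBall (x := (0:E)) (ε := 1))
    ⟨_, continuousOn_iff_continuous_domRestrict.1 hu⟩
  have hgu : ∀ x, ‖x‖ ≤ 1 → g x = u x := fun x hx =>
    congrArg (fun F => F ⟨x, by simpa using hx⟩) hg
  obtain ⟨x, hx, h⟩ := brouwer_zero g g.continuous (fun x hx => by rw [hgu x hx]; exact hb x hx)
  exact ⟨x, hx, by rw [← hgu x hx]; exact h⟩

theorem compact_lower {X E : Type*} [TopologicalSpace X] [NormedAddCommGroup E] {S : Set X}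
    (hS : IsCompact S) {g : X → E} (hg : ContinuousOn g S) (h0 : ∀ y ∈ S, g y ≠ 0) :
    ∃ m > 0, ∀ y ∈ S, m ≤ ‖g y‖ := by
  rcases S.eq_empty_or_nonempty with rfl | hne
  · exact ⟨1, one_pos, by simp⟩
  · obtain ⟨x, hx, hm⟩ := hS.exists_isMinOn hne hg.norm
    exact ⟨‖g x‖, norm_pos_iff.2 (h0 x hx), fun y hy => hm hy⟩

theorem inv_dom0 {E : Type*} [NormedAddCommGroup E] [InnerProductSpace ℝ E]
    [FiniteDimensional ℝ E] [Nontrivial E] (f : E → E) (hf : ContinuousOn f (closedBall 0 1))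
    (hi : InjOn f (closedBall 0 1)) : f '' closedBall 0 1 ∈ 𝓝 (f 0) := by
  by_contra hK
  borelize E
  let μ : Measure E := Measure.addHaar
  have hKc : IsCompact (f '' closedBall 0 1) := (isCompact_closedBall (0:E) 1).image_of_continuousOn hf
  set K := f '' closedBall 0 1 with hKdef
  have : CompactSpace (closedBall (0:E) 1) := isCompact_iff_compactSpace.1 (isCompact_closedBall _ _)
  have he : IsClosedEmbedding ((closedBall (0:E) 1).domRestrict f) :=
    (continuousOn_iff_continuous_domRestrict.1 hf).isClosedEmbedding (injOn_iff_injective.1 hi)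
  obtain ⟨G, hG⟩ := ContinuousMap.exists_extension' he
    (⟨Subtype.val, continuous_subtype_val⟩ : C(closedBall (0:E) 1, E))
  have hGf : ∀ x, ‖x‖ ≤ 1 → G (f x) = x := fun x hx => congrFun hG ⟨x, by simpa using hx⟩
  have hG0 : G (f 0) = 0 := hGf 0 (by simp)
  obtain ⟨ε₃, hε₃, hGs⟩ := Metric.continuousAt_iff.1 (G.continuous.continuousAt (x := f 0)) (1/10)
    (by norm_num)
  simp only [hG0, dist_zero_right] at hGs
  obtain ⟨ε, hε, hε2⟩ : ∃ ε > 0, 2 * ε < ε₃ := ⟨ε₃ / 3, by positivity, by linarith⟩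
  obtain ⟨c, hc, hcK⟩ : ∃ c, dist c (f 0) < ε ∧ c ∉ K := by
    by_contra hcon
    push Not at hcon
    exact hK (Metric.mem_nhds_iff.2 ⟨ε, hε, fun c hc => hcon c hc⟩)
  have hS1 : IsCompact (K ∩ {y | ε ≤ ‖y - c‖}) :=
    hKc.inter_right (isClosed_le continuous_const (by fun_prop))
  obtain ⟨m, hm, hmin⟩ := compact_lower hS1 G.continuous.continuousOn (by
    rintro y ⟨⟨x, hx, rfl⟩, hy⟩ h
    rw [hGf x (by simpa using hx)] at h
    subst h
    simp only [mem_ofPred_eq, ← dist_eq_norm, dist_comm (f 0)] at hy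
    linarith)
  set η := min m (1/10) / 2 with hη
  have hηpos : 0 < η := by positivity
  have hη1 : 2 * η ≤ m := by
    have := min_le_left m (1/10); linarith
  have hη2 : 2 * η ≤ 1/10 := by
    have := min_le_right m (1/10); linarith
  obtain ⟨P, hP, hPG, -⟩ := G.continuous.exists_contDiff_approx 1 (ε := fun _ => η)
    continuous_const (fun _ => hηpos)
  have hnull : μ (P '' sphere c ε) = 0 :=
    addHaar_image_eq_zero_of_differentiableOn_of_addHaar_eq_zero μ
      (hP.differentiable one_ne_zero).differentiableOn (Measure.addHaar_sphere μ c ε)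
  obtain ⟨v, hv, hvP⟩ : ∃ v, ‖v‖ < η ∧ v ∉ P '' sphere c ε := by
    by_contra hcon
    push Not at hcon
    have h1 : μ (ball (0:E) η) ≤ μ (P '' sphere c ε) :=
      measure_mono fun v hv => hcon v (by simpa using hv)
    rw [hnull] at h1
    exact absurd (measure_ball_pos μ (0:E) hηpos) (not_lt.2 h1)
  let Q : E → E := fun y => P y - v
  have hQG : ∀ y, ‖Q y - G y‖ < 2 * η := by
    intro y
    have h1 := hPG y
    rw [dist_eq_norm] at h1
    have : Q y - G y = (P y - G y) - v := by simp only [Q]; abel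
    rw [this]
    have := norm_sub_le (P y - G y) v
    linarith
  let Φ : E → E := fun y => c + max (ε / ‖y - c‖) 1 • (y - c)
  have hΦ1 : ∀ y, ε ≤ ‖y - c‖ → Φ y = y := by
    intro y hy
    have : ε / ‖y - c‖ ≤ 1 := div_le_one_of_le₀ hy (norm_nonneg _)
    simp [Φ, max_eq_right this]
  have hΦ2 : ∀ y, y ≠ c → ‖y - c‖ < ε → ‖Φ y - c‖ = ε := by
    intro y hyc hy
    have hp : 0 < ‖y - c‖ := norm_pos_iff.2 (sub_ne_zero.2 hyc)
    have : 1 ≤ ε / ‖y - c‖ := (one_le_div hp).2 hy.le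
    simp only [Φ, max_eq_left this, add_sub_cancel_left, norm_smul, norm_div,
      Real.norm_eq_abs, abs_norm, abs_of_pos hε]
    field_simp
  have hfK : ∀ x, ‖x‖ ≤ 1 → f x ∈ K := fun x hx => ⟨x, by simpa using hx, rfl⟩
  have hfc : ∀ x, ‖x‖ ≤ 1 → f x ≠ c := fun x hx h => hcK (h ▸ hfK x hx)
  have hΦc : ContinuousOn (fun x => Φ (f x)) (closedBall 0 1) := by
    have h1 : ContinuousOn (fun x => f x - c) (closedBall 0 1) := hf.sub continuousOn_const
    have h2 : ContinuousOn (fun x => ε / ‖f x - c‖) (closedBall 0 1) :=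
      continuousOn_const.div h1.norm (fun x hx => norm_ne_zero_iff.2
        (sub_ne_zero.2 (hfc x (by simpa using hx))))
    exact continuousOn_const.add ((h2.sup continuousOn_const).smul h1)
  have hQc : Continuous Q := hP.continuous.sub continuous_const
  obtain ⟨x, hx, hx0⟩ := brouwer_zero_on (fun x => Q (Φ (f x)) - x)
    ((hQc.comp_continuousOn hΦc).sub continuousOn_id) (by
    intro x hx
    by_cases hy : ε ≤ ‖f x - c‖
    · rw [hΦ1 _ hy]
      have := hQG (f x)
      rw [hGf x hx] at this
      linarith
    · push Not at hy
      have hd1 : ∀ y, ‖y - c‖ ≤ ε → ‖G y‖ < 1/10 := by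
        intro y hy
        apply hGs
        have := dist_triangle y c (f 0)
        rw [dist_eq_norm y c] at this
        linarith
      have h1 := hd1 _ hy.le
      rw [hGf x hx] at h1
      have h2 := hd1 _ (hΦ2 _ (hfc x hx) hy).le
      have h3 := hQG (Φ (f x))
      have h4 := norm_sub_le (Q (Φ (f x))) x
      have h5 := norm_add_le (Q (Φ (f x)) - G (Φ (f x))) (G (Φ (f x)))
      rw [sub_add_cancel] at h5
      linarith)
  simp only [add_sub_cancel] at hx0
  by_cases hy : ε ≤ ‖f x - c‖
  · rw [hΦ1 _ hy] at hx0
    have h1 := hQG (f x)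
    rw [hx0, zero_sub, norm_neg] at h1
    have h2 := hmin (f x) ⟨hfK x hx, hy⟩
    linarith
  · push Not at hy
    exact hvP ⟨Φ (f x), by simpa [dist_eq_norm] using hΦ2 _ (hfc x hx) hy, sub_eq_zero.1 hx0⟩

theorem inv_dom {E : Type*} [NormedAddCommGroup E] [InnerProductSpace ℝ E]
    [FiniteDimensional ℝ E] (f : E → E) {U : Set E} (hU : IsOpen U) (hf : ContinuousOn f U)
    (hi : InjOn f U) : IsOpen (f '' U) := by
  rcases subsingleton_or_nontrivial E with hE | hE
  · exact isOpen_discrete _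
  rw [isOpen_iff_mem_nhds]
  rintro _ ⟨a, ha, rfl⟩
  obtain ⟨ρ, hρ, hρU⟩ := Metric.nhds_basis_closedBall.mem_iff.1 (hU.mem_nhds ha)
  let A : E → E := fun x => a + ρ • x
  have hA : MapsTo A (closedBall 0 1) U := by
    intro x hx
    apply hρU
    have : ‖x‖ ≤ 1 := by simpa using hx
    simp only [A, mem_closedBall, dist_self_add_left, norm_smul, Real.norm_eq_abs, abs_of_pos hρ]
    nlinarith
  have hAi : Function.Injective A := by
    intro x y h
    simpa [A, hρ.ne'] using h
  have hAc : Continuous A := by fun_prop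
  have := inv_dom0 (f ∘ A) (hf.comp hAc.continuousOn hA) (hi.comp hAi.injOn hA)
  have h0 : (f ∘ A) 0 = f a := by simp [A]
  rw [h0] at this
  refine mem_of_superset this ?_
  rintro _ ⟨x, hx, rfl⟩
  exact ⟨A x, hA hx, rfl⟩

end Aux

/-- The simplicial monoid `Germ₀(ℝⁿ)` of germs at the origin of
self-embeddings of `ℝⁿ` fixing the origin is a simplicial group: every `k`-simplex
(represented by `σ`) has a two-sided inverse germ (represented by `τ`) under germ
composition, i.e. `τ_x ∘ σ_x = id` and `σ_x ∘ τ_x = id` on a sufficiently small ball,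
uniformly over the `k`-simplex. -/
theorem statement5 (n k : ℕ) (σ : GermZeroRep n k) :
    ∃ τ : GermZeroRep n k, ∃ s : ℝ, 0 < s ∧ s ≤ σ.r ∧ s ≤ τ.r ∧
      ∀ x ∈ stdSimplex ℝ (Fin (k + 1)), ∀ z ∈ ball (0 : EuclideanSpace ℝ (Fin n)) s,
        (σ.σ x z ∈ ball (0 : EuclideanSpace ℝ (Fin n)) τ.r ∧ τ.σ x (σ.σ x z) = z) ∧
        (τ.σ x z ∈ ball (0 : EuclideanSpace ℝ (Fin n)) σ.r ∧ σ.σ x (τ.σ x z) = z) := by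
  classical
  set Δ := stdSimplex ℝ (Fin (k + 1)) with hΔ
  have hΔc : IsCompact Δ := isCompact_stdSimplex ℝ (Fin (k + 1))
  obtain ⟨R, hR, hRr⟩ : ∃ R > 0, R < σ.r := ⟨σ.r / 2, half_pos σ.r_pos, half_lt_self σ.r_pos⟩
  have hsub : closedBall (0 : EuclideanSpace ℝ (Fin n)) R ⊆ ball 0 σ.r := closedBall_subset_ball hRr
  have hCc : IsCompact (Δ ×ˢ closedBall (0 : EuclideanSpace ℝ (Fin n)) R) := hΔc.prod (isCompact_closedBall _ _)
  have hcont : ContinuousOn (fun p : (Fin (k + 1) → ℝ) × EuclideanSpace ℝ (Fin n) => σ.σ p.1 p.2)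
      (Δ ×ˢ closedBall (0 : EuclideanSpace ℝ (Fin n)) R) := σ.cont.mono (Set.prod_mono_right hsub)
  have h0mem : (0 : EuclideanSpace ℝ (Fin n)) ∈ closedBall (0 : EuclideanSpace ℝ (Fin n)) R := by simp [hR.le]
  obtain ⟨m, hm, hmin⟩ := compact_lower (hΔc.prod (isCompact_sphere (0 : EuclideanSpace ℝ (Fin n)) R))
    (hcont.mono (Set.prod_mono_right sphere_subset_closedBall)) (by
    rintro ⟨x, z⟩ ⟨hx, hz⟩ h
    simp only at hx hz h
    have := σ.inj x hx (hsub (sphere_subset_closedBall hz)) (hsub h0mem) (h.trans (σ.fix x hx).symm)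
    rw [this] at hz
    simp at hz
    exact hR.ne hz)
  have hcx : ∀ x ∈ Δ, ContinuousOn (σ.σ x) (closedBall (0 : EuclideanSpace ℝ (Fin n)) R) := by
    intro x hx
    exact hcont.comp (f := fun z : EuclideanSpace ℝ (Fin n) => (x, z)) (by fun_prop) (fun z hz => ⟨hx, hz⟩)
  have hsurj : ∀ x ∈ Δ, ∀ y ∈ ball (0 : EuclideanSpace ℝ (Fin n)) m, ∃ z ∈ closedBall (0 : EuclideanSpace ℝ (Fin n)) R, σ.σ x z = y := by
    intro x hx
    have ho : IsOpen (σ.σ x '' ball (0 : EuclideanSpace ℝ (Fin n)) R) := inv_dom _ isOpen_ball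
      ((hcx x hx).mono ball_subset_closedBall)
      ((σ.inj x hx).mono (ball_subset_closedBall.trans hsub))
    have hcl : closure (σ.σ x '' ball (0 : EuclideanSpace ℝ (Fin n)) R) ⊆ σ.σ x '' closedBall (0 : EuclideanSpace ℝ (Fin n)) R :=
      closure_minimal (Set.image_mono ball_subset_closedBall)
        ((isCompact_closedBall (0 : EuclideanSpace ℝ (Fin n)) R).image_of_continuousOn (hcx x hx)).isClosed
    have hss : ball (0 : EuclideanSpace ℝ (Fin n)) m ⊆ σ.σ x '' ball (0 : EuclideanSpace ℝ (Fin n)) R := by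
      refine (convex_ball (0 : EuclideanSpace ℝ (Fin n)) m).isPreconnected.subset_of_closure_inter_subset ho
        ⟨0, by simpa using hm, 0, by simpa using hR, σ.fix x hx⟩ ?_
      rintro y ⟨hy, hym⟩
      obtain ⟨z, hz, rfl⟩ := hcl hy
      refine ⟨z, ?_, rfl⟩
      by_contra hzb
      have h1 : ‖z‖ = R := le_antisymm (by simpa using hz) (by simpa using hzb)
      have h2 := hmin (x, z) ⟨hx, by simpa using h1⟩
      simp at hym
      simp at h2
      linarith
    intro y hy
    obtain ⟨z, hz, h⟩ := hss hy
    exact ⟨z, ball_subset_closedBall hz, h⟩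
  let t : (Fin (k + 1) → ℝ) → EuclideanSpace ℝ (Fin n) → EuclideanSpace ℝ (Fin n) := fun x => Function.invFunOn (σ.σ x) (closedBall (0 : EuclideanSpace ℝ (Fin n)) R)
  have ht1 : ∀ x ∈ Δ, ∀ y ∈ ball (0 : EuclideanSpace ℝ (Fin n)) m, t x y ∈ closedBall (0 : EuclideanSpace ℝ (Fin n)) R := fun x hx y hy =>
    Function.invFunOn_mem (hsurj x hx y hy)
  have ht2 : ∀ x ∈ Δ, ∀ y ∈ ball (0 : EuclideanSpace ℝ (Fin n)) m, σ.σ x (t x y) = y := fun x hx y hy =>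
    Function.invFunOn_eq (hsurj x hx y hy)
  have ht3 : ∀ x ∈ Δ, ∀ z ∈ closedBall (0 : EuclideanSpace ℝ (Fin n)) R, t x (σ.σ x z) = z := fun x hx z hz =>
    ((σ.inj x hx).mono hsub).leftInvOn_invFunOn hz
  let Ψ : (Fin (k + 1) → ℝ) × EuclideanSpace ℝ (Fin n) → (Fin (k + 1) → ℝ) × EuclideanSpace ℝ (Fin n) := fun p => (p.1, σ.σ p.1 p.2)
  have hΨ : ContinuousOn Ψ (Δ ×ˢ closedBall (0 : EuclideanSpace ℝ (Fin n)) R) := continuousOn_fst.prodMk hcont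
  have htc : ContinuousOn (fun q : (Fin (k + 1) → ℝ) × EuclideanSpace ℝ (Fin n) => t q.1 q.2)
      (Ψ '' (Δ ×ˢ closedBall (0 : EuclideanSpace ℝ (Fin n)) R)) := by
    rw [continuousOn_iff_isClosed]
    intro u hu
    refine ⟨Ψ '' ((Δ ×ˢ closedBall (0 : EuclideanSpace ℝ (Fin n)) R) ∩ Prod.snd ⁻¹' u), ?_, ?_⟩
    · exact ((hCc.inter_right (hu.preimage continuous_snd)).image_of_continuousOn
        (hΨ.mono Set.inter_subset_left)).isClosed
    · ext q
      constructor
      · rintro ⟨hq, p, hp, rfl⟩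
        refine ⟨⟨p, ⟨hp, ?_⟩, rfl⟩, p, hp, rfl⟩
        have := ht3 p.1 hp.1 p.2 hp.2
        simp only [Set.mem_preimage, Ψ, this] at hq
        exact hq
      · rintro ⟨⟨p, ⟨hp, hpu⟩, rfl⟩, h⟩
        refine ⟨?_, h⟩
        have := ht3 p.1 hp.1 p.2 hp.2
        simp only [Set.mem_preimage, Ψ, this]
        exact hpu
  let τ : GermZeroRep n k :=
    { r := m
      r_pos := hm
      σ := t
      cont := htc.mono (by
        rintro ⟨x, y⟩ ⟨hx, hy⟩
        exact ⟨(x, t x y), ⟨hx, ht1 x hx y hy⟩, Prod.ext rfl (ht2 x hx y hy)⟩)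
      inj := by
        intro x hx y hy y' hy' h
        rw [← ht2 x hx y hy, h, ht2 x hx y' hy']
      fix := by
        intro x hx
        have := ht3 x hx 0 h0mem
        rwa [σ.fix x hx] at this }
  have hT : IsCompact ((Δ ×ˢ closedBall (0 : EuclideanSpace ℝ (Fin n)) R) ∩
      (fun p : (Fin (k + 1) → ℝ) × EuclideanSpace ℝ (Fin n) => ‖σ.σ p.1 p.2‖) ⁻¹' Set.Ici m) :=
    hCc.of_isClosed_subset (hcont.norm.preimage_isClosed_of_isClosed hCc.isClosed isClosed_Ici)
      Set.inter_subset_left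
  obtain ⟨s₀, hs₀, hs⟩ := compact_lower hT (g := Prod.snd) continuousOn_snd (by
    rintro ⟨x, z⟩ ⟨⟨hx, -⟩, hz⟩ h
    simp only at h hx
    subst h
    simp [σ.fix x hx] at hz
    linarith)
  refine ⟨τ, min s₀ (min R m), by positivity, ?_, ?_, ?_⟩
  · exact (min_le_right _ _).trans ((min_le_left _ _).trans hRr.le)
  · exact (min_le_right _ _).trans (min_le_right _ _)
  · intro x hx z hz
    have hz' : ‖z‖ < min s₀ (min R m) := by simpa using hz
    obtain ⟨hz1, hz2⟩ := lt_min_iff.1 hz'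
    obtain ⟨hz2, hz3⟩ := lt_min_iff.1 hz2
    have hzR : z ∈ closedBall (0 : EuclideanSpace ℝ (Fin n)) R := by simpa using hz2.le
    have hzm : z ∈ ball (0 : EuclideanSpace ℝ (Fin n)) m := by simpa using hz3
    refine ⟨⟨?_, ht3 x hx z hzR⟩, hsub (ht1 x hx z hzm), ht2 x hx z hzm⟩
    by_contra hcon
    have h1 : m ≤ ‖σ.σ x z‖ := by
      have : ¬ ‖σ.σ x z‖ < m := by simpa using hcon
      exact not_lt.1 this
    have h2 : s₀ ≤ ‖z‖ := hs (x, z) ⟨⟨hx, hzR⟩, h1⟩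
    linarith
end

section
/- Let M be an n-manifold and S a finite set. The evaluation map Germ(S, M) → Sing Conf(S, M) is a principal fibration for the simplicial group Germ₀(ℝⁿ)^S: the right action of Germ₀(ℝⁿ)^S on each fiber is free and transitive, i.e., the induced map Germ(S,M)_k / (Germ₀(ℝⁿ)^S)_k → Sing(Conf(S,M))_k is a bijection for every k. -/
open Metric

/-- A representative of a `k`-simplex of the space `Germ(S, M)` of `S`-germs of `M`:
a continuous family, parametrized by the topological `k`-simplex, of embeddings of
`S × Bⁿ(r)` into `M`. -/
structure GermSRep (n k : ℕ) (S M : Type*) [TopologicalSpace S] [TopologicalSpace M] where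
  r : ℝ
  r_pos : 0 < r
  σ : (Fin (k + 1) → ℝ) → S → EuclideanSpace ℝ (Fin n) → M
  cont : ContinuousOn
    (fun p : (Fin (k + 1) → ℝ) × S × EuclideanSpace ℝ (Fin n) => σ p.1 p.2.1 p.2.2)
    ((stdSimplex ℝ (Fin (k + 1))) ×ˢ
      ((Set.univ : Set S) ×ˢ ball (0 : EuclideanSpace ℝ (Fin n)) r))
  inj : ∀ x ∈ stdSimplex ℝ (Fin (k + 1)),
    Set.InjOn (fun q : S × EuclideanSpace ℝ (Fin n) => σ x q.1 q.2)
      ((Set.univ : Set S) ×ˢ ball (0 : EuclideanSpace ℝ (Fin n)) r)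

section PartOne

open MeasureTheory Set Filter Topology
open scoped NNReal

variable {E : Type*} [NormedAddCommGroup E] [InnerProductSpace ℝ E] [FiniteDimensional ℝ E]

lemma det_interp_s6 (t0 : ℝ) (ht0 : 0 < t0) :
    ∃ (N : ℕ) (s w : Fin N → ℝ), (∀ i, 0 < s i ∧ s i < t0) ∧ ∑ i, w i = 1 ∧
      ∀ A : E →L[ℝ] E, (ContinuousLinearMap.id ℝ E + A).det =
        ∑ i, w i * (ContinuousLinearMap.id ℝ E + s i • A).det := by
  classical
  set n := Module.finrank ℝ E with hn
  let b := Module.finBasis ℝ E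
  let s : Fin (n + 1) → ℝ := fun i => t0 * ((i : ℝ) + 1) / ((n : ℝ) + 2)
  have hn2 : (0 : ℝ) < (n : ℝ) + 2 := by positivity
  have hsinj : Set.InjOn s (Finset.univ : Finset (Fin (n+1))) := by
    intro i _ j _ hij
    simp only [s] at hij
    field_simp at hij
    have : (i : ℝ) = j := by linarith
    exact Fin.ext (by exact_mod_cast this)
  refine ⟨n + 1, s, fun i => (Lagrange.basis Finset.univ s i).eval 1, ?_, ?_, ?_⟩
  · intro i
    have : (i : ℝ) ≤ n := by
      have := Nat.lt_succ_iff.1 i.2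
      exact_mod_cast this
    refine ⟨by positivity, ?_⟩
    simp only [s]
    rw [div_lt_iff₀ hn2]
    exact mul_lt_mul_of_pos_left (by linarith) ht0
  · rw [← Polynomial.eval_finsetSum, Lagrange.sum_basis hsinj ⟨0, Finset.mem_univ _⟩]
    simp
  · intro A
    let M := LinearMap.toMatrix b b (A : E →ₗ[ℝ] E)
    let p : Polynomial ℝ := Matrix.det ((Polynomial.X : Polynomial ℝ) • M.map Polynomial.C +
      (1 : Matrix (Fin n) (Fin n) ℝ).map Polynomial.C)
    have hp : ∀ t : ℝ, p.eval t = (ContinuousLinearMap.id ℝ E + t • A).det := by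
      intro t
      have h1 : p.eval t = Matrix.det (t • M + 1) := by
        have := RingHom.map_det (Polynomial.evalRingHom t)
          ((Polynomial.X : Polynomial ℝ) • M.map Polynomial.C +
            (1 : Matrix (Fin n) (Fin n) ℝ).map Polynomial.C)
        simp only [Polynomial.coe_evalRingHom] at this
        rw [show p.eval t = _ from this]
        congr 1
        ext i j
        by_cases h : i = j <;> simp [h] <;> exact mul_comm _ _
      rw [h1]
      have h2 : (ContinuousLinearMap.id ℝ E + t • A).det =
        LinearMap.det ((ContinuousLinearMap.id ℝ E + t • A : E →L[ℝ] E) : E →ₗ[ℝ] E) := rfl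
      rw [h2, ← LinearMap.det_toMatrix b]
      congr 1
      have : ((ContinuousLinearMap.id ℝ E + t • A : E →L[ℝ] E) : E →ₗ[ℝ] E) =
        LinearMap.id + t • (A : E →ₗ[ℝ] E) := by ext; simp
      rw [this, map_add, map_smul, LinearMap.toMatrix_id, add_comm]
    have hdeg : p.degree < (Finset.univ : Finset (Fin (n+1))).card := by
      refine lt_of_le_of_lt Polynomial.degree_le_natDegree ?_
      have := Polynomial.natDegree_det_X_add_C_le M (1 : Matrix (Fin n) (Fin n) ℝ)
      simp only [Fintype.card_fin] at this
      simp only [Finset.card_univ, Fintype.card_fin]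
      exact_mod_cast Nat.lt_succ_of_le this
    have h := Lagrange.eq_interpolate (v := s) hsinj hdeg
    have h1 := hp 1
    rw [one_smul] at h1
    rw [← h1]
    conv_lhs => rw [h]
    rw [Lagrange.interpolate_apply, Polynomial.eval_finsetSum]
    refine Finset.sum_congr rfl fun i _ => ?_
    simp [hp, mul_comm]

lemma det_pos_near : ∃ δ > 0, ∀ A : E →L[ℝ] E, ‖A‖ < δ →
    0 < (ContinuousLinearMap.id ℝ E + A).det := by
  have h : ContinuousAt (fun A : E →L[ℝ] E => (ContinuousLinearMap.id ℝ E + A).det) 0 :=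
    (ContinuousLinearMap.continuous_det.comp (by fun_prop)).continuousAt
  have h2 : ∀ᶠ A in 𝓝 (0 : E →L[ℝ] E), 0 < (ContinuousLinearMap.id ℝ E + A).det := by
    apply h.eventually (lt_mem_nhds _)
    simp [ContinuousLinearMap.det]
  obtain ⟨δ, hδ, h3⟩ := Metric.eventually_nhds_iff.1 h2
  exact ⟨δ, hδ, fun A hA => h3 (by simpa using hA)⟩

/-- extension by zero is Lipschitz -/
lemma lip_ext (h : E → E) (L : ℝ≥0) (hL : LipschitzOnWith L h (closedBall 0 1))
    (h0 : ∀ x, ‖x‖ = 1 → h x = 0) [DecidablePred fun x : E => ‖x‖ < 1] :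
    LipschitzWith L (fun x => if ‖x‖ < 1 then h x else 0) := by
  have key : ∀ x y : E, ‖x‖ < 1 → ¬ ‖y‖ < 1 → ‖h x‖ ≤ L * ‖x - y‖ := by
    intro x y hx hy
    push Not at hy
    have hc : ContinuousOn (fun t : ℝ => ‖x + t • (y - x)‖) (Icc 0 1) := by fun_prop
    obtain ⟨t, ht, hxt⟩ := intermediate_value_Icc (zero_le_one) hc
      (show (1:ℝ) ∈ Icc _ _ from ⟨by simpa using hx.le, by simpa using hy⟩)
    simp only at hxt
    have := hL.dist_le_mul x (by simpa using hx.le) (x + t • (y - x)) (by simp [hxt])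
    rw [h0 _ hxt, dist_zero_right] at this
    refine this.trans ?_
    rw [dist_eq_norm, sub_add_cancel_left, norm_neg, norm_smul, Real.norm_of_nonneg ht.1,
      norm_sub_rev y x]
    have : t * ‖x - y‖ ≤ ‖x - y‖ := mul_le_of_le_one_left (norm_nonneg _) ht.2
    exact mul_le_mul_of_nonneg_left this L.2
  refine LipschitzWith.of_dist_le_mul fun x y => ?_
  rw [dist_eq_norm, dist_eq_norm]
  by_cases hx : ‖x‖ < 1 <;> by_cases hy : ‖y‖ < 1 <;> simp only [hx, hy, if_true, if_false]
  · rw [← dist_eq_norm, ← dist_eq_norm]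
    exact hL.dist_le_mul x (by simpa using hx.le) y (by simpa using hy.le)
  · simpa using key x y hx hy
  · rw [norm_sub_rev x y]; simpa using key y x hy hx
  · simp; positivity

lemma image_ball_eq (k : E → E) (L : ℝ≥0) (hL : LipschitzWith L k)
    (hk : ∀ x, ¬ ‖x‖ < 1 → k x = 0) (t : ℝ) (ht : 0 ≤ t) (htL : t * L < 1) :
    Function.Injective (fun x => x + t • k x) ∧
      (fun x => x + t • k x) '' ball 0 1 = ball 0 1 := by
  have hinj : Function.Injective (fun x => x + t • k x) := by
    intro x y hxy
    simp only at hxy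
    have h1 : x - y = t • (k y - k x) := by
      rw [smul_sub, sub_eq_sub_iff_add_eq_add, hxy, add_comm]
    have h2 : ‖x - y‖ ≤ t * L * ‖x - y‖ := by
      conv_lhs => rw [h1]
      rw [norm_smul, Real.norm_of_nonneg ht, mul_assoc, norm_sub_rev, ← dist_eq_norm,
        ← dist_eq_norm]
      exact mul_le_mul_of_nonneg_left (hL.dist_le_mul x y) ht
    have h3 : ‖x - y‖ = 0 := by
      by_contra hne
      have : 0 < ‖x - y‖ := lt_of_le_of_ne (norm_nonneg _) (Ne.symm hne)
      nlinarith
    exact sub_eq_zero.1 (norm_eq_zero.1 h3)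
  refine ⟨hinj, ?_⟩
  ext y
  simp only [mem_image, mem_ball_zero_iff]
  constructor
  · rintro ⟨x, hx, rfl⟩
    by_contra hy
    have : (fun x => x + t • k x) (x + t • k x) = (fun x => x + t • k x) x := by
      simp only [hk _ hy, smul_zero, add_zero]
    have := hinj this
    rw [this] at hy
    exact hy hx
  · intro hy
    have hc : ContractingWith (t.toNNReal * L) (fun x => y - t • k x) := by
      refine ⟨by rw [← NNReal.coe_lt_coe]; simpa [Real.coe_toNNReal t ht] using htL, ?_⟩
      refine LipschitzWith.of_dist_le_mul fun a b => ?_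
      rw [dist_sub_left, dist_smul₀, Real.norm_of_nonneg ht]
      rw [NNReal.coe_mul, Real.coe_toNNReal t ht, mul_assoc]
      exact mul_le_mul_of_nonneg_left (hL.dist_le_mul _ _) ht
    have hfix := hc.fixedPoint_isFixedPt
    set x := ContractingWith.fixedPoint (fun x => y - t • k x) hc
    have hx : x + t • k x = y := by
      have : y - t • k x = x := hfix
      rw [← sub_eq_iff_eq_add.1 this]
    refine ⟨x, ?_, hx⟩
    by_contra hxn
    rw [hk _ hxn] at hx
    simp at hx
    rw [hx] at hxn
    exact hxn hy

lemma no_retraction (v : E → E) (hv : ContDiff ℝ 1 v) (hn : ∀ x, ‖v x‖ = 1)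
    (hs : ∀ x, ‖x‖ = 1 → v x = x) : False := by
  classical
  borelize E
  set h : E → E := fun x => v x - x with hh
  have hhc : ContDiff ℝ 1 h := hv.sub contDiff_id
  obtain ⟨L, hL⟩ : ∃ L, LipschitzOnWith L h (closedBall 0 1) := by
    have : LocallyLipschitz h := hhc.locallyLipschitz
    exact (this.locallyLipschitzOn (s := closedBall (0:E) 1)).exists_lipschitzOnWith_of_compact
      (isCompact_closedBall 0 1)
  have hkL := lip_ext h L hL (fun x hx => by simp [hh, hs x hx])
  set k : E → E := fun x => if ‖x‖ < 1 then h x else 0 with hk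
  have hk0 : ∀ x, ¬ ‖x‖ < 1 → k x = 0 := fun x hx => by simp [hk, hx]
  -- derivative
  set D : E → E →L[ℝ] E := fun x => fderiv ℝ h x with hD
  have hDc : Continuous D := hhc.continuous_fderiv (by norm_num)
  have hkD : ∀ x ∈ ball (0 : E) 1, HasFDerivAt k (D x) x := by
    intro x hx
    have h1 : HasFDerivAt h (D x) x := (hhc.differentiable (by norm_num) x).hasFDerivAt
    refine h1.congr_of_eventuallyEq ?_
    filter_upwards [isOpen_ball.mem_nhds hx] with y hy
    simp only [mem_ball_zero_iff] at hy
    simp [hk, hy]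
  obtain ⟨C, hC⟩ : ∃ C, ∀ x ∈ closedBall (0:E) 1, ‖D x‖ ≤ C :=
    (isCompact_closedBall (0:E) 1).exists_bound_of_continuousOn hDc.continuousOn
  obtain ⟨δ, hδ, hdet⟩ := det_pos_near (E := E)
  set t0 : ℝ := min (1 / (L + 1)) (δ / (|C| + 1)) with ht0
  have hL1 : (0:ℝ) < L + 1 := by positivity
  have hC1 : (0:ℝ) < |C| + 1 := by positivity
  have ht0pos : 0 < t0 := by positivity
  set μ : Measure E := Measure.addHaar
  have hint : ∀ t : ℝ, IntegrableOn (fun x => (ContinuousLinearMap.id ℝ E + t • D x).det)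
      (ball 0 1) μ := by
    intro t
    have hc : Continuous (fun x => (ContinuousLinearMap.id ℝ E + t • D x).det) :=
      ContinuousLinearMap.continuous_det.comp (by fun_prop)
    exact (hc.continuousOn.integrableOn_compact (isCompact_closedBall (0:E) 1)).mono_set
      ball_subset_closedBall
  have hvol : ∀ t : ℝ, 0 < t → t < t0 →
      ∫ x in ball (0:E) 1, (ContinuousLinearMap.id ℝ E + t • D x).det ∂μ = μ.real (ball 0 1) := by
    intro t ht htt
    have htL : t * L < 1 := by
      have : t < 1 / (L + 1) := htt.trans_le (min_le_left _ _)
      rw [lt_div_iff₀ hL1] at this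
      linarith [ht]
    obtain ⟨hinj, him⟩ := image_ball_eq k L hkL hk0 t ht.le htL
    have hpos : ∀ x ∈ ball (0:E) 1, 0 < (ContinuousLinearMap.id ℝ E + t • D x).det := by
      intro x hx
      apply hdet
      rw [norm_smul, Real.norm_of_nonneg ht.le]
      have h1 := hC x (ball_subset_closedBall hx)
      have h2 : t < δ / (|C| + 1) := htt.trans_le (min_le_right _ _)
      rw [lt_div_iff₀ hC1] at h2
      have : t * ‖D x‖ ≤ t * (|C| + 1) :=
        mul_le_mul_of_nonneg_left (by linarith [le_abs_self C]) ht.le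
      linarith
    have hcv := integral_image_eq_integral_abs_det_fderiv_smul μ (s := ball (0:E) 1)
      (f := fun x => x + t • k x) (f' := fun x => ContinuousLinearMap.id ℝ E + t • D x)
      measurableSet_ball
      (fun x hx => ((hasFDerivAt_id x).add ((hkD x hx).const_smul t)).hasFDerivWithinAt)
      hinj.injOn (fun _ => (1:ℝ))
    rw [him] at hcv
    simp only [smul_eq_mul, mul_one, integral_const, measureReal_restrict_apply_univ] at hcv
    rw [hcv]
    refine setIntegral_congr_fun measurableSet_ball fun x hx => ?_
    exact (abs_of_pos (hpos x hx)).symm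
  obtain ⟨N, s, w, hsw, hw1, hint2⟩ := det_interp_s6 (E := E) t0 ht0pos
  have hfin : ∫ x in ball (0:E) 1, (ContinuousLinearMap.id ℝ E + D x).det ∂μ
      = μ.real (ball 0 1) := by
    rw [show (fun x => (ContinuousLinearMap.id ℝ E + D x).det) = fun x => ∑ i, w i * (ContinuousLinearMap.id ℝ E + s i • D x).det from funext fun x => hint2 (D x)]
    rw [integral_finsetSum]
    · simp_rw [integral_const_mul]
      rw [Finset.sum_congr rfl fun i _ => by rw [hvol (s i) (hsw i).1 (hsw i).2],
        ← Finset.sum_mul, hw1, one_mul]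
    · intro i _
      exact (hint (s i)).const_mul _
  have hzero : ∀ x, (ContinuousLinearMap.id ℝ E + D x).det = 0 := by
    intro x
    have hvd : HasFDerivAt v (ContinuousLinearMap.id ℝ E + D x) x := by
      have h1 : HasFDerivAt h (D x) x := (hhc.differentiable (by norm_num) x).hasFDerivAt
      have := (hasFDerivAt_id x).add h1
      refine this.congr_of_eventuallyEq (Eventually.of_forall fun y => ?_)
      simp [hh]
    set A := ContinuousLinearMap.id ℝ E + D x
    have hsq : HasFDerivAt (fun y => (inner ℝ (v y) (v y) : ℝ)) (0 : E →L[ℝ] ℝ) x := by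
      have : (fun y => inner ℝ (v y) (v y)) = fun _ => (1:ℝ) := by
        ext y; rw [real_inner_self_eq_norm_sq, hn]; norm_num
      rw [this]; exact hasFDerivAt_const _ _
    have h2 := (hvd.inner ℝ hvd).unique hsq
    have horth : ∀ y, inner ℝ (v x) (A y) = 0 := by
      intro y
      have := congrArg (fun T : E →L[ℝ] ℝ => T y) h2
      simp [fderivInnerCLM_apply] at this
      rw [real_inner_comm (v x) (A y)] at this
      rw [real_inner_comm]
      rw [real_inner_comm] at this
      linarith
    by_contra hne
    have hu : IsUnit (LinearMap.det (A : E →ₗ[ℝ] E)) := isUnit_iff_ne_zero.2 hne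
    rw [← LinearMap.isUnit_iff_isUnit_det] at hu
    obtain ⟨y, hy⟩ := ((Module.End.isUnit_iff _).1 hu).2 (v x)
    have := horth y
    rw [show A y = v x from hy, real_inner_self_eq_norm_sq, hn] at this
    norm_num at this
  simp only [hzero, integral_zero] at hfin
  have : 0 < μ.real (ball (0:E) 1) :=
    ENNReal.toReal_pos (measure_ball_pos μ 0 one_pos).ne' measure_ball_lt_top.ne
  linarith

end PartOne

section PartTwo

open MeasureTheory Set Filter Topology

variable {E : Type*} [NormedAddCommGroup E] [InnerProductSpace ℝ E] [FiniteDimensional ℝ E]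

lemma zero_of_close (H : E → E) (hH : Continuous H)
    (hc : ∀ x, ‖x‖ ≤ 1 → ‖H x - x‖ ≤ 1 / 2) : ∃ x, ‖x‖ ≤ 1 ∧ H x = 0 := by
  by_contra hno
  push Not at hno
  let χ : E → ℝ := fun x => max 0 (min 1 (8 * (7 / 8 - ‖x‖)))
  have hχc : Continuous χ := by fun_prop
  have hχ0 : ∀ x, 0 ≤ χ x := fun x => le_max_left _ _
  have hχ1 : ∀ x, χ x ≤ 1 := fun x => max_le zero_le_one (min_le_left _ _)
  have hχin : ∀ x, ‖x‖ ≤ 3 / 4 → χ x = 1 := by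
    intro x hx
    simp only [χ]
    rw [min_eq_left (by linarith), max_eq_right zero_le_one]
  have hχout : ∀ x, 7 / 8 ≤ ‖x‖ → χ x = 0 := by
    intro x hx
    simp only [χ]
    exact max_eq_left ((min_le_right _ _).trans (by linarith))
  let u : E → E := fun x => x + χ x • (H x - x)
  have huc : Continuous u := by fun_prop
  have hu0 : ∀ x, u x ≠ 0 := by
    intro x
    by_cases h1 : ‖x‖ ≤ 3 / 4
    · simp only [u, hχin x h1, one_smul, add_sub_cancel]
      exact hno x (by linarith)
    · push Not at h1
      by_cases h2 : ‖x‖ ≤ 1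
      · intro hu
        have h3 : x = - (χ x • (H x - x)) := eq_neg_of_add_eq_zero_left hu
        have h4 : ‖x‖ ≤ 1 / 2 := by
          rw [h3, norm_neg, norm_smul, Real.norm_of_nonneg (hχ0 x)]
          have := mul_le_mul (hχ1 x) (hc x h2) (norm_nonneg _) zero_le_one
          linarith
        linarith
      · push Not at h2
        simp only [u, hχout x (by linarith), zero_smul, add_zero]
        intro h; rw [h] at h2; simp at h2; linarith
  have huid : ∀ x, 7 / 8 ≤ ‖x‖ → u x = x := fun x hx => by simp [u, hχout x hx]
  obtain ⟨g, hg, hgd, hgeq, -⟩ := huc.exists_contDiff_approx_and_eqOn 1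
    (ε := fun x => ‖u x‖) (by fun_prop) (fun x => norm_pos_iff.2 (hu0 x))
    (S := {x | 1 ≤ ‖x‖}) (U := {x | 7 / 8 < ‖x‖})
    (isClosed_le continuous_const continuous_norm)
    ((isOpen_lt continuous_const continuous_norm).mem_nhdsSet.2
      (fun x (hx : 1 ≤ ‖x‖) => show 7 / 8 < ‖x‖ by linarith))
    (contDiffOn_id.congr fun x hx => huid x (le_of_lt hx))
  have hg0 : ∀ x, g x ≠ 0 := by
    intro x h
    have := hgd x
    simp [h] at this
  refine no_retraction (fun x => ‖g x‖⁻¹ • g x) ?_ ?_ ?_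
  · have hg' : ContDiff ℝ 1 g := hg
    exact ((hg'.norm ℝ hg0).inv (fun x => norm_ne_zero_iff.2 (hg0 x))).smul hg'
  · intro x
    simp [norm_smul, norm_ne_zero_iff.2 (hg0 x)]
  · intro x hx
    have : g x = x := (hgeq (show 1 ≤ ‖x‖ by rw [hx])).trans (huid x (by rw [hx]; norm_num))
    simp [this, hx]

lemma image_mem_nhds (f : E → E) (hf : Continuous f) (hinj : InjOn f (closedBall 0 1)) :
    f '' closedBall 0 1 ∈ 𝓝 (f 0) := by
  borelize E
  set B : Set E := closedBall 0 1 with hB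
  have hBc : IsCompact B := isCompact_closedBall _ _
  have : CompactSpace B := isCompact_iff_compactSpace.1 hBc
  set K := f '' B with hK
  have hKc : IsCompact K := hBc.image hf
  have h0B : (0 : E) ∈ B := by simp [hB]
  have he : IsClosedEmbedding (B.domRestrict f) :=
    (hf.comp continuous_subtype_val).isClosedEmbedding (injOn_iff_injective.1 hinj)
  obtain ⟨G, hG⟩ := ContinuousMap.exists_extension' he
    (⟨Subtype.val, continuous_subtype_val⟩ : C(B, E))
  have hGf : ∀ x ∈ B, G (f x) = x := fun x hx => congrFun hG ⟨x, hx⟩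
  by_contra hnot
  have hG0 : G (f 0) = 0 := hGf 0 h0B
  obtain ⟨ε', hε', hGε⟩ : ∃ ε' > 0, ∀ y, dist y (f 0) < ε' → ‖G y‖ < 1 / 10 := by
    have h1 : ∀ᶠ y in 𝓝 (f 0), ‖G y‖ < 1 / 10 := by
      have : ContinuousAt (fun y => ‖G y‖) (f 0) := by fun_prop
      exact this.eventually (gt_mem_nhds (by simp [hG0]))
    exact Metric.eventually_nhds_iff.1 h1
  set ε := ε' / 3 with hεdef
  have hε : 0 < ε := by positivity
  obtain ⟨c, hcε, hcK⟩ : ∃ c, dist c (f 0) < ε ∧ c ∉ K := by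
    by_contra hall
    push Not at hall
    exact hnot (Metric.mem_nhds_iff.2 ⟨ε, hε, fun y hy => hall y hy⟩)
  obtain ⟨η, hη, hηK⟩ : ∃ η > 0, ∀ y ∈ K, η ≤ ‖y - c‖ := by
    have : Kᶜ ∈ 𝓝 c := hKc.isClosed.isOpen_compl.mem_nhds hcK
    obtain ⟨η, hη, h⟩ := Metric.mem_nhds_iff.1 this
    refine ⟨η, hη, fun y hy => ?_⟩
    by_contra hlt
    push Not at hlt
    exact h (show y ∈ ball c η by rwa [mem_ball, dist_eq_norm]) hy
  let Φ : E → E := fun y => c + (max (ε / max ‖y - c‖ η) 1) • (y - c)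
  have hΦc : Continuous Φ := by
    have : Continuous fun y : E => ε / max ‖y - c‖ η :=
      continuous_const.div (by fun_prop) (fun y => (lt_of_lt_of_le hη (le_max_right _ _)).ne')
    fun_prop
  -- Σ1
  have hS1c : IsCompact (K ∩ {y | ε ≤ ‖y - c‖}) :=
    hKc.inter_right (isClosed_le continuous_const (by fun_prop))
  have hGne : ∀ y ∈ K ∩ {y | ε ≤ ‖y - c‖}, 0 < ‖G y‖ := by
    rintro y ⟨⟨x, hx, rfl⟩, hy⟩
    rw [hGf x hx, norm_pos_iff]
    rintro rfl
    rw [mem_ofPred_eq, ← dist_eq_norm, dist_comm] at hy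
    linarith
  obtain ⟨δ, hδ, hδ1, hδG⟩ : ∃ δ > 0, δ ≤ 1 / 10 ∧ ∀ y ∈ K ∩ {y | ε ≤ ‖y - c‖}, δ ≤ ‖G y‖ := by
    obtain ⟨d, hd, h⟩ := hS1c.exists_forall_le' (f := fun y => ‖G y‖) (by fun_prop) hGne
    exact ⟨min d (1 / 10), by positivity, min_le_right _ _, fun y hy => (min_le_left _ _).trans (h y hy)⟩
  obtain ⟨P, hP, hPG, -⟩ := G.continuous.exists_contDiff_approx 1 (ε := fun _ => δ / 2)
    continuous_const (fun _ => by positivity)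
  have hPd : Differentiable ℝ P := hP.differentiable (by norm_num)
  have hnull : (Measure.addHaar : Measure E) (P '' sphere c ε) = 0 :=
    addHaar_image_eq_zero_of_differentiableOn_of_addHaar_eq_zero _ hPd.differentiableOn
      (Measure.addHaar_sphere_of_ne_zero _ c hε.ne')
  obtain ⟨a, ha, haP⟩ : ∃ a, ‖a‖ < δ / 2 ∧ a ∉ P '' sphere c ε := by
    by_contra hall
    push Not at hall
    have : ball (0 : E) (δ / 2) ⊆ P '' sphere c ε := fun a ha => hall a (by simpa using ha)
    have h1 := measure_mono_null this hnull
    exact (measure_ball_pos (Measure.addHaar : Measure E) 0 (half_pos hδ)).ne' h1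
  have hPa : ∀ y, ‖P y - a - G y‖ < δ := by
    intro y
    have h1 := hPG y
    rw [dist_eq_norm] at h1
    calc ‖P y - a - G y‖ = ‖(P y - G y) - a‖ := by congr 1; abel
      _ ≤ ‖P y - G y‖ + ‖a‖ := norm_sub_le _ _
      _ < δ := by linarith
  have hmain : ∀ x, ‖x‖ ≤ 1 → P (Φ (f x)) - a ≠ 0 ∧ ‖(P (Φ (f x)) - a) - x‖ ≤ 1 / 2 := by
    intro x hx
    have hxB : x ∈ B := by simpa [hB] using hx
    have hyK : f x ∈ K := ⟨x, hxB, rfl⟩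
    have hmax : max ‖f x - c‖ η = ‖f x - c‖ := max_eq_left (hηK _ hyK)
    have hpos : 0 < ‖f x - c‖ := hη.trans_le (hηK _ hyK)
    by_cases hy : ε ≤ ‖f x - c‖
    · have hΦ : Φ (f x) = f x := by
        simp only [Φ, hmax]
        rw [max_eq_right ((div_le_one hpos).2 hy)]
        simp
      rw [hΦ]
      have h1 := hPa (f x)
      have h2 := hδG (f x) ⟨hyK, hy⟩
      constructor
      · intro h0
        rw [h0, zero_sub, norm_neg] at h1
        linarith
      · rw [hGf x hxB] at h1
        linarith
    · push Not at hy
      have hΦ : ‖Φ (f x) - c‖ = ε := by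
        simp only [Φ, hmax]
        rw [max_eq_left ((one_le_div hpos).2 hy.le), add_sub_cancel_left, norm_smul,
          Real.norm_of_nonneg (by positivity)]
        field_simp
      constructor
      · intro h0
        exact haP ⟨Φ (f x), by simpa [dist_eq_norm] using hΦ, sub_eq_zero.1 h0⟩
      · have h1 := hPa (Φ (f x))
        have h2 : ‖G (Φ (f x))‖ < 1 / 10 := by
          apply hGε
          have := dist_triangle (Φ (f x)) c (f 0)
          rw [dist_eq_norm (Φ (f x)) c, hΦ] at this
          linarith
        have h3 : ‖G (f x)‖ < 1 / 10 := by
          apply hGε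
          have := dist_triangle (f x) c (f 0)
          rw [dist_eq_norm (f x) c] at this
          linarith
        rw [hGf x hxB] at h3
        calc ‖(P (Φ (f x)) - a) - x‖ = ‖(P (Φ (f x)) - a - G (Φ (f x))) + (G (Φ (f x)) - x)‖ := by
              congr 1; abel
          _ ≤ ‖P (Φ (f x)) - a - G (Φ (f x))‖ + (‖G (Φ (f x))‖ + ‖x‖) :=
              (norm_add_le _ _).trans (by gcongr; exact norm_sub_le _ _)
          _ ≤ 1 / 2 := by linarith
  obtain ⟨x, hx, hx0⟩ := zero_of_close (fun x => P (Φ (f x)) - a)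
    ((hPd.continuous.comp (hΦc.comp hf)).sub continuous_const) (fun x hx => (hmain x hx).2)
  exact (hmain x hx).1 hx0

end PartTwo

section PartThree

open Set Filter Topology

variable {E : Type*} [NormedAddCommGroup E] [NormedSpace ℝ E] [FiniteDimensional ℝ E]

/-- Invariance of domain -/
lemma invariance_of_domain (f : E → E) (U : Set E) (hU : IsOpen U) (hf : ContinuousOn f U)
    (hinj : InjOn f U) {x : E} (hx : x ∈ U) : f '' U ∈ 𝓝 (f x) := by
  let e := toEuclidean (E := E)
  -- rescale
  have hUe : e.symm ⁻¹' U ∈ 𝓝 (e x) :=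
    e.symm.continuous.continuousAt.preimage_mem_nhds (by simpa using hU.mem_nhds hx)
  obtain ⟨r, hr, hrU⟩ := Metric.nhds_basis_closedBall.mem_iff.1 hUe
  let F : EuclideanSpace ℝ (Fin (Module.finrank ℝ E)) → EuclideanSpace ℝ (Fin (Module.finrank ℝ E)) :=
    fun z => e (f (e.symm (e x + r • z)))
  have hmem : ∀ z ∈ closedBall (0 : EuclideanSpace ℝ (Fin (Module.finrank ℝ E))) 1,
      e.symm (e x + r • z) ∈ U := by
    intro z hz
    apply hrU
    simp only [mem_closedBall, dist_self_add_left, norm_smul, Real.norm_of_nonneg hr.le]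
    have : ‖z‖ ≤ 1 := by simpa using hz
    nlinarith
  have hFc : ContinuousOn F (closedBall 0 1) :=
    e.continuous.comp_continuousOn (hf.comp (Continuous.continuousOn (by fun_prop)) hmem)
  have hFi : InjOn F (closedBall 0 1) := by
    intro a ha b hb hab
    have h1 := hinj (hmem a ha) (hmem b hb) (e.injective hab)
    have h2 := add_left_cancel (e.symm.injective h1)
    exact smul_right_injective _ hr.ne' h2
  obtain ⟨F', hF'⟩ := ContinuousMap.exists_restrict_eq (isClosed_closedBall)
    (⟨_, hFc.domRestrict⟩ : C(closedBall (0 : EuclideanSpace ℝ (Fin (Module.finrank ℝ E))) 1, _))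
  have hFF : EqOn F' F (closedBall 0 1) := fun z hz => congrArg (fun φ => φ ⟨z, hz⟩) hF'
  have key := image_mem_nhds F' F'.continuous (hFi.congr hFF.symm)
  rw [hFF (by simp), hFF.image_eq] at key
  have h3 : e ⁻¹' (F '' closedBall 0 1) ∈ 𝓝 (f x) := by
    apply e.continuous.continuousAt.preimage_mem_nhds
    simpa [F] using key
  refine mem_of_superset h3 ?_
  rintro y ⟨z, hz, hzy⟩
  exact ⟨_, hmem z hz, e.injective hzy⟩

end PartThree

section PartFour

open Set Filter Topology

lemma tube_aux {X V : Type*} [TopologicalSpace X] [NormedAddCommGroup V]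
    {K : Set X} (hK : IsCompact K) (P : X → V → Prop) (r : ℝ) (hr : 0 < r)
    (h : ∀ x ∈ K, ∀ᶠ q : X × V in 𝓝[K ×ˢ ball (0 : V) r] (x, 0), P q.1 q.2) :
    ∃ s > 0, s ≤ r ∧ ∀ x ∈ K, ∀ z ∈ ball (0 : V) s, P x z := by
  have key : ∃ s > 0, s ≤ r ∧ ∀ x ∈ K, x ∈ K → ∀ z ∈ ball (0 : V) s, P x z := by
    refine hK.induction_on (p := fun S => ∃ s > 0, s ≤ r ∧ ∀ x ∈ S, x ∈ K →
      ∀ z ∈ ball (0 : V) s, P x z) ⟨r, hr, le_rfl, by simp⟩ ?_ ?_ ?_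
    · rintro S T hST ⟨s, hs, hsr, h1⟩
      exact ⟨s, hs, hsr, fun x hx => h1 x (hST hx)⟩
    · rintro S T ⟨s, hs, hsr, h1⟩ ⟨t, ht, htr, h2⟩
      refine ⟨min s t, lt_min hs ht, (min_le_left _ _).trans hsr, ?_⟩
      rintro x (hx | hx) hxK z hz
      · exact h1 x hx hxK z (ball_subset_ball (min_le_left _ _) hz)
      · exact h2 x hx hxK z (ball_subset_ball (min_le_right _ _) hz)
    · intro x hx
      have h1 := h x hx
      rw [nhdsWithin_prod_eq, nhdsWithin_eq_nhds.2 (ball_mem_nhds (0 : V) hr)] at h1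
      obtain ⟨pa, hpa, pb, hpb, hab⟩ := eventually_prod_iff.1 h1
      obtain ⟨s, hs, hsb⟩ := Metric.eventually_nhds_iff_ball.1 hpb
      refine ⟨{y | pa y}, hpa, min s r, lt_min hs hr, min_le_right _ _, ?_⟩
      intro y hy _ z hz
      exact hab hy (hsb z (ball_subset_ball (min_le_left _ _) hz))
  obtain ⟨s, hs, hsr, h1⟩ := key
  exact ⟨s, hs, hsr, fun x hx => h1 x hx hx⟩

variable {X V M : Type*} [NormedAddCommGroup X] [NormedSpace ℝ X] [FiniteDimensional ℝ X]
  [NormedAddCommGroup V] [NormedSpace ℝ V] [FiniteDimensional ℝ V]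
  [TopologicalSpace M] [ChartedSpace V M]

lemma open_lem {K : Set X} (ρ : X → X) (hρ : Continuous ρ) (hρK : ∀ x, ρ x ∈ K)
    (hρid : ∀ x ∈ K, ρ x = x) (r : ℝ) (σ : X → V → M)
    (hc : ContinuousOn (fun p : X × V => σ p.1 p.2) (K ×ˢ ball 0 r))
    (hi : ∀ x ∈ K, InjOn (σ x) (ball 0 r)) (O : Set V) (hO : IsOpen O) (hOr : O ⊆ ball 0 r)
    {x0 : X} (hx0 : x0 ∈ K) {z0 : V} (hz0 : z0 ∈ O) :
    {q : X × M | ∃ z ∈ O, σ (ρ q.1) z = q.2} ∈ 𝓝 (x0, σ x0 z0) := by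
  let φ := chartAt V (σ x0 z0)
  let F : X × V → M := fun q => σ (ρ q.1) q.2
  have hFc : ContinuousOn F (univ ×ˢ O) := by
    refine hc.comp (f := fun q : X × V => (ρ q.1, q.2)) (by fun_prop) ?_
    rintro ⟨x, z⟩ ⟨_, hz⟩
    exact ⟨hρK x, hOr hz⟩
  let Ω : Set (X × V) := (univ ×ˢ O) ∩ F ⁻¹' φ.source
  have hΩ : IsOpen Ω := hFc.isOpen_inter_preimage (isOpen_univ.prod hO) φ.open_source
  let f : X × V → X × V := fun q => (q.1, φ (F q))
  have hfc : ContinuousOn f Ω := by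
    refine continuousOn_fst.prodMk ?_
    exact φ.continuousOn.comp (hFc.mono inter_subset_left) (fun q hq => hq.2)
  have hfi : InjOn f Ω := by
    rintro ⟨x, z⟩ ⟨⟨_, hz⟩, h1⟩ ⟨y, w⟩ ⟨⟨_, hw⟩, h2⟩ h
    simp only [f, Prod.mk.injEq] at h
    obtain ⟨rfl, h⟩ := h
    have h3 : F (x, z) = F (x, w) := φ.injOn h1 h2 h
    exact Prod.ext rfl (hi (ρ x) (hρK x) (hOr hz) (hOr hw) h3)
  have hF0 : F (x0, z0) = σ x0 z0 := by simp only [F, hρid x0 hx0]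
  have hmem : (x0, z0) ∈ Ω := by
    refine ⟨⟨mem_univ _, hz0⟩, ?_⟩
    rw [mem_preimage, hF0]
    exact mem_chart_source V _
  have key := invariance_of_domain f Ω hΩ hfc hfi hmem
  have hcA : ContinuousAt (fun q : X × M => (q.1, φ q.2)) (x0, σ x0 z0) := by
    refine continuousAt_fst.prodMk ?_
    exact ContinuousAt.comp (g := φ) (f := Prod.snd) (x := (x0, σ x0 z0))
      (φ.continuousAt (mem_chart_source V _)) continuousAt_snd
  have h1 := hcA.preimage_mem_nhds (t := f '' Ω) (by simpa only [f, hF0] using key)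
  have h2 : {q : X × M | q.2 ∈ φ.source} ∈ 𝓝 (x0, σ x0 z0) :=
    continuousAt_snd.preimage_mem_nhds (φ.open_source.mem_nhds (mem_chart_source V _))
  filter_upwards [h1, h2] with q hq1 hq2
  obtain ⟨⟨x, z⟩, ⟨⟨_, hz⟩, hs⟩, hqe⟩ := hq1
  simp only [f, Prod.mk.injEq] at hqe
  obtain ⟨rfl, h⟩ := hqe
  exact ⟨z, hz, φ.injOn hs hq2 h⟩

lemma trans_lem {K : Set X} (hK : IsCompact K) (ρ : X → X) (hρ : Continuous ρ)
    (hρK : ∀ x, ρ x ∈ K) (hρid : ∀ x ∈ K, ρ x = x)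
    (r : ℝ) (hr : 0 < r) (σ : X → V → M)
    (hc : ContinuousOn (fun p : X × V => σ p.1 p.2) (K ×ˢ ball 0 r))
    (hi : ∀ x ∈ K, InjOn (σ x) (ball 0 r))
    (r' : ℝ) (hr' : 0 < r') (τ : X → V → M)
    (hc' : ContinuousOn (fun p : X × V => τ p.1 p.2) (K ×ˢ ball 0 r'))
    (h0 : ∀ x ∈ K, σ x 0 = τ x 0) :
    ∃ s > 0, s ≤ r' ∧ ∃ g : X → V → V,
      ContinuousOn (fun p : X × V => g p.1 p.2) (K ×ˢ ball 0 s) ∧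
      ∀ x ∈ K, ∀ z ∈ ball (0 : V) s, g x z ∈ ball (0 : V) r ∧ σ x (g x z) = τ x z := by
  classical
  have hgraph : ∀ x ∈ K, ∀ z ∈ ball (0 : V) r',
      Tendsto (fun q : X × V => (q.1, τ q.1 q.2)) (𝓝[K ×ˢ ball (0 : V) r'] (x, z))
        (𝓝 (x, τ x z)) := by
    intro x hx z hz
    exact (continuousWithinAt_fst.prodMk (hc' (x, z) ⟨hx, hz⟩))
  obtain ⟨s, hs, hsr, hex⟩ := tube_aux hK (fun x z => ∃ z' ∈ ball (0 : V) r, σ x z' = τ x z) r' hr' (by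
    intro x hx
    have h1 := open_lem ρ hρ hρK hρid r σ hc hi (ball 0 r) isOpen_ball subset_rfl hx
      (mem_ball_self hr)
    rw [h0 x hx] at h1
    filter_upwards [hgraph x hx 0 (mem_ball_self hr') h1, self_mem_nhdsWithin] with q hq hqK
    simp only [mem_preimage, mem_ofPred_eq, hρid q.1 hqK.1] at hq
    exact hq)
  let g : X → V → V := fun x z =>
    if h : ∃ z' ∈ ball (0 : V) r, σ x z' = τ x z then h.choose else 0
  have hg : ∀ x ∈ K, ∀ z ∈ ball (0 : V) s, g x z ∈ ball (0 : V) r ∧ σ x (g x z) = τ x z := by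
    intro x hx z hz
    have h := hex x hx z hz
    simp only [g, dif_pos h]
    exact h.choose_spec
  refine ⟨s, hs, hsr, g, ?_, hg⟩
  rintro ⟨x, z⟩ ⟨hx, hz⟩
  obtain ⟨hgr, hge⟩ := hg x hx z hz
  simp only at hx hz
  rw [ContinuousWithinAt, _root_.tendsto_nhds]
  intro O hO hzO
  have h1 := open_lem ρ hρ hρK hρid r σ hc hi (O ∩ ball 0 r) (hO.inter isOpen_ball)
    inter_subset_right hx ⟨hzO, hgr⟩
  rw [hge] at h1
  have h2 := ((hgraph x hx z (ball_subset_ball hsr hz)).mono_left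
    (nhdsWithin_mono _ (prod_mono subset_rfl (ball_subset_ball hsr)))) h1
  filter_upwards [h2, self_mem_nhdsWithin] with q hq hqK
  simp only [mem_preimage, mem_ofPred_eq, hρid q.1 hqK.1] at hq
  obtain ⟨z', ⟨hz'O, hz'r⟩, he⟩ := hq
  obtain ⟨h3, h4⟩ := hg q.1 hqK.1 q.2 hqK.2
  have : g q.1 q.2 = z' := hi q.1 hqK.1 h3 hz'r (h4.trans he.symm)
  rw [mem_preimage, this]
  exact hz'O

/-- triviality of the germ bundle over `K` along `c` -/
def TrivOn (V : Type*) [NormedAddCommGroup V] {X M : Type*} [TopologicalSpace X]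
    [TopologicalSpace M] (c : X → M) (K : Set X) : Prop :=
  ∃ r > 0, ∃ σ : X → V → M, ContinuousOn (fun p : X × V => σ p.1 p.2) (K ×ˢ ball 0 r) ∧
    (∀ x ∈ K, InjOn (σ x) (ball 0 r)) ∧ ∀ x ∈ K, σ x 0 = c x

lemma triv_local (c : X → M) (hc : Continuous c) {K : Set X} (hK : IsCompact K) (m : M)
    (hm : ∀ x ∈ K, c x ∈ (chartAt V m).source) : TrivOn V c K := by
  let φ := chartAt V m
  have hψ : ContinuousOn (fun q : X × V => φ (c q.1) + q.2) (K ×ˢ univ) :=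
    (φ.continuousOn.comp (by fun_prop) (fun q hq => hm q.1 hq.1)).add continuousOn_snd
  obtain ⟨r, hr, -, ht⟩ := tube_aux hK (fun x (z : V) => φ (c x) + z ∈ φ.target) 1 one_pos (by
    intro x hx
    have h1 : ContinuousWithinAt (fun q : X × V => φ (c q.1) + q.2) (K ×ˢ ball (0:V) 1) (x, 0) :=
      (hψ (x, 0) ⟨hx, mem_univ _⟩).mono (prod_mono subset_rfl (subset_univ _))
    refine h1 (φ.open_target.mem_nhds ?_)
    simpa using φ.map_source (hm x hx))
  refine ⟨r, hr, fun x z => φ.symm (φ (c x) + z), ?_, ?_, ?_⟩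
  · exact φ.continuousOn_symm.comp (hψ.mono (prod_mono subset_rfl (subset_univ _)))
      (fun q hq => ht q.1 hq.1 q.2 hq.2)
  · intro x hx z hz w hw h
    exact add_left_cancel (φ.symm.injOn (ht x hx z hz) (ht x hx w hw) h)
  · intro x hx
    simp only [add_zero]
    exact φ.left_inv (hm x hx)

lemma triv_glue (c : X → M) {K1 K2 : Set X} (h1 : IsClosed K1) (h2 : IsClosed K2)
    (hK : IsCompact (K1 ∩ K2)) (ρ : X → X) (hρ : Continuous ρ) (hρK : ∀ x, ρ x ∈ K1 ∩ K2)
    (hρid : ∀ x ∈ K1 ∩ K2, ρ x = x) (ht1 : TrivOn V c K1) (ht2 : TrivOn V c K2) :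
    TrivOn V c (K1 ∪ K2) := by
  classical
  obtain ⟨r1, hr1, σ1, hc1, hi1, hz1⟩ := ht1
  obtain ⟨r2, hr2, σ2, hc2, hi2, hz2⟩ := ht2
  obtain ⟨s, hs, hsr, g, hgc, hg⟩ := trans_lem hK ρ hρ hρK hρid r2 hr2 σ2
    (hc2.mono (prod_mono inter_subset_right subset_rfl)) (fun x hx => hi2 x hx.2) r1 hr1 σ1
    (hc1.mono (prod_mono inter_subset_left subset_rfl))
    (fun x hx => (hz2 x hx.2).trans (hz1 x hx.1).symm)
  have hg0 : ∀ x ∈ K1 ∩ K2, g x 0 = 0 := by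
    intro x hx
    obtain ⟨ha, hb⟩ := hg x hx 0 (mem_ball_self hs)
    refine hi2 x hx.2 ha (mem_ball_self hr2) ?_
    rw [hb, hz1 x hx.1, hz2 x hx.2]
  have hginj : ∀ x ∈ K1 ∩ K2, InjOn (g x) (ball 0 s) := by
    intro x hx a ha b hb hab
    refine hi1 x hx.1 (ball_subset_ball hsr ha) (ball_subset_ball hsr hb) ?_
    rw [← (hg x hx a ha).2, ← (hg x hx b hb).2, hab]
  let σ : X → V → M := fun x z => if x ∈ K1 then σ1 x z else σ2 x (g (ρ x) z)
  have hσ1 : ∀ x ∈ K1, ∀ z, σ x z = σ1 x z := fun x hx z => if_pos hx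
  have hσ2 : ∀ x ∈ K2, ∀ z ∈ ball (0 : V) s, σ x z = σ2 x (g (ρ x) z) := by
    intro x hx z hz
    by_cases hx1 : x ∈ K1
    · rw [hσ1 x hx1, hρid x ⟨hx1, hx⟩, (hg x ⟨hx1, hx⟩ z hz).2]
    · exact if_neg hx1
  have hA : ContinuousOn (fun p : X × V => σ p.1 p.2) (K1 ×ˢ ball 0 s) :=
    (hc1.mono (prod_mono subset_rfl (ball_subset_ball hsr))).congr
      (fun q hq => hσ1 q.1 hq.1 q.2)
  have hB : ContinuousOn (fun p : X × V => σ p.1 p.2) (K2 ×ˢ ball 0 s) := by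
    have hgρ : ContinuousOn (fun q : X × V => g (ρ q.1) q.2) (K2 ×ˢ ball 0 s) :=
      hgc.comp (f := fun q : X × V => (ρ q.1, q.2)) (by fun_prop) (fun q hq => ⟨hρK _, hq.2⟩)
    have : ContinuousOn (fun p : X × V => σ2 p.1 (g (ρ p.1) p.2)) (K2 ×ˢ ball 0 s) :=
      hc2.comp (f := fun q : X × V => (q.1, g (ρ q.1) q.2)) (continuousOn_fst.prodMk hgρ)
        (fun q hq => ⟨hq.1, (hg _ (hρK _) _ hq.2).1⟩)
    exact this.congr (fun q hq => hσ2 q.1 hq.1 q.2 hq.2)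
  have hext : ∀ (K : Set X), IsClosed K →
      ContinuousOn (fun p : X × V => σ p.1 p.2) (K ×ˢ ball 0 s) → ∀ q : X × V, q.2 ∈ ball (0:V) s →
      ContinuousWithinAt (fun p : X × V => σ p.1 p.2) (K ×ˢ ball 0 s) q := by
    intro K hKc hcont q hq
    by_cases h : q.1 ∈ K
    · exact hcont q ⟨h, hq⟩
    · apply continuousWithinAt_of_notMem_closure
      rw [closure_prod_eq, hKc.closure_eq]
      exact fun h' => h h'.1
  refine ⟨s, hs, σ, ?_, ?_, ?_⟩
  · intro q hq
    rw [union_prod]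
    exact (hext K1 h1 hA q hq.2).union (hext K2 h2 hB q hq.2)
  · rintro x hx a ha b hb hab
    by_cases hx1 : x ∈ K1
    · rw [hσ1 x hx1, hσ1 x hx1] at hab
      exact hi1 x hx1 (ball_subset_ball hsr ha) (ball_subset_ball hsr hb) hab
    · have hx2 : x ∈ K2 := hx.resolve_left hx1
      rw [hσ2 x hx2 a ha, hσ2 x hx2 b hb] at hab
      exact hginj _ (hρK x) ha hb
        (hi2 x hx2 (hg _ (hρK x) a ha).1 (hg _ (hρK x) b hb).1 hab)
  · intro x hx
    by_cases hx1 : x ∈ K1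
    · rw [hσ1 x hx1, hz1 x hx1]
    · have hx2 : x ∈ K2 := hx.resolve_left hx1
      rw [hσ2 x hx2 0 (mem_ball_self hs), hg0 _ (hρK x), hz2 x hx2]

lemma triv_box {ι : Type*} [Fintype ι] (c : (ι → ℝ) → M) (hc : Continuous c)
    (A B : ι → ℝ) (hAB : A ≤ B) : TrivOn V c (Icc A B) := by
  classical
  obtain ⟨δ, hδ, hleb⟩ := lebesgue_number_lemma_of_metric (isCompact_Icc (a := A) (b := B))
    (c := fun m : M => c ⁻¹' (chartAt V m).source)
    (fun m => (chartAt V m).open_source.preimage hc)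
    (fun x _ => mem_iUnion.2 ⟨c x, mem_chart_source V (c x)⟩)
  have key : ∀ T : Finset ι, ∀ a b : ι → ℝ, a ≤ b → Icc a b ⊆ Icc A B →
      (∀ i, i ∉ T → b i - a i ≤ δ / 2) → TrivOn V c (Icc a b) := by
    intro T
    induction T using Finset.induction_on with
    | empty =>
      intro a b hab hsub hlen
      obtain ⟨m, hm⟩ := hleb a (hsub ⟨le_rfl, hab⟩)
      refine triv_local c hc isCompact_Icc m fun x hx => hm ?_
      rw [mem_ball]
      refine lt_of_le_of_lt ((dist_pi_le_iff (by positivity : 0 ≤ δ / 2)).2 fun i => ?_)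
        (half_lt_self hδ)
      rw [Real.dist_eq, abs_of_nonneg (sub_nonneg.2 (hx.1 i))]
      have := hx.2 i
      have := hlen i (by simp)
      linarith
    | insert i T hiT ih =>
      have hN : ∀ N : ℕ, ∀ a b : ι → ℝ, a ≤ b → Icc a b ⊆ Icc A B →
          (∀ j, j ∉ insert i T → b j - a j ≤ δ / 2) → b i - a i ≤ N * (δ / 2) →
          TrivOn V c (Icc a b) := by
        intro N
        induction N with
        | zero =>
          intro a b hab hsub hlen hi
          refine ih a b hab hsub fun j hj => ?_
          by_cases hji : j = i
          · subst hji; simp at hi; linarith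
          · exact hlen j (by simp [hji, hj])
        | succ N ihN =>
          intro a b hab hsub hlen hi
          by_cases hle : b i - a i ≤ δ / 2
          · refine ih a b hab hsub fun j hj => ?_
            by_cases hji : j = i
            · subst hji; exact hle
            · exact hlen j (by simp [hji, hj])
          · push Not at hle
            set t := a i + δ / 2 with ht
            set a' := Function.update a i t with ha'
            set b' := Function.update b i t with hb'
            have haa' : a ≤ a' := by
              intro j
              by_cases hji : j = i
              · subst hji; simp [ha', ht]; positivity
              · simp [ha', hji]
            have hb'b : b' ≤ b := by
              intro j
              by_cases hji : j = i
              · subst hji; simp [hb', ht]; linarith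
              · simp [hb', hji]
            have ha'b' : a' ≤ b' := by
              intro j
              by_cases hji : j = i
              · subst hji; simp [ha', hb']
              · simp [ha', hb', hji]; exact hab j
            have hU : Icc a b = Icc a b' ∪ Icc a' b := by
              ext x
              constructor
              · rintro ⟨hx1, hx2⟩
                rcases le_total (x i) t with h | h
                · left
                  refine ⟨hx1, fun j => ?_⟩
                  by_cases hji : j = i
                  · subst hji; simpa [hb'] using h
                  · simpa [hb', hji] using hx2 j
                · right
                  refine ⟨fun j => ?_, hx2⟩
                  by_cases hji : j = i
                  · subst hji; simpa [ha'] using h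
                  · simpa [ha', hji] using hx1 j
              · rintro (⟨hx1, hx2⟩ | ⟨hx1, hx2⟩)
                · exact ⟨hx1, hx2.trans hb'b⟩
                · exact ⟨haa'.trans hx1, hx2⟩
            have hI : Icc a b' ∩ Icc a' b = Icc a' b' := by
              rw [Icc_inter_Icc, sup_eq_right.2 haa', inf_eq_left.2 hb'b]
            rw [hU] at hsub ⊢
            refine triv_glue c isClosed_Icc isClosed_Icc (by rw [hI]; exact isCompact_Icc)
              (fun x => a' ⊔ (x ⊓ b'))
              (continuous_pi fun j => continuous_const.max ((continuous_apply j).min continuous_const)) ?_ ?_ ?_ ?_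
            · intro x
              rw [hI]
              exact ⟨le_sup_left, sup_le ha'b' inf_le_right⟩
            · intro x hx
              rw [hI] at hx
              change a' ⊔ (x ⊓ b') = x
              rw [inf_eq_left.2 hx.2, sup_eq_right.2 hx.1]
            · refine ih a b' (haa'.trans ha'b') (subset_union_left.trans hsub) fun j hj => ?_
              by_cases hji : j = i
              · subst hji; simp [hb', ht]
              · simpa [hb', hji] using hlen j (by simp [hji, hj])
            · refine ihN a' b (ha'b'.trans hb'b) (subset_union_right.trans hsub) ?_ ?_
              · intro j hj
                have hji : j ≠ i := by rintro rfl; simp at hj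
                simpa [ha', hji] using hlen j hj
              · simp only [ha', Function.update_self, ht]
                push_cast at hi
                linarith
      intro a b hab hsub hlen
      obtain ⟨N, hN'⟩ := exists_nat_ge ((b i - a i) / (δ / 2))
      exact hN N a b hab hsub hlen ((div_le_iff₀ (by positivity)).1 hN')
  exact key Finset.univ A B hAB subset_rfl (fun i hi => absurd (Finset.mem_univ i) hi)

lemma simplex_retract (k : ℕ) : ∃ ρ : (Fin (k + 1) → ℝ) → (Fin (k + 1) → ℝ), Continuous ρ ∧
    (∀ x, ρ x ∈ stdSimplex ℝ (Fin (k + 1))) ∧ ∀ x ∈ stdSimplex ℝ (Fin (k + 1)), ρ x = x := by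
  let t : (Fin (k + 1) → ℝ) → ℝ := fun x => ∑ j, max (x j) 0
  have ht0 : ∀ x, 0 ≤ t x := fun x => Finset.sum_nonneg fun j _ => le_max_right _ _
  have htc : Continuous t := by fun_prop
  have hpos : ∀ x, 0 < max 1 (t x) := fun x => lt_of_lt_of_le one_pos (le_max_left _ _)
  refine ⟨fun x i => (max (x i) 0 + max (1 - t x) 0 / ((k : ℝ) + 1)) / max 1 (t x), ?_, ?_, ?_⟩
  · refine continuous_pi fun i => Continuous.div (by fun_prop) (by fun_prop) fun x => (hpos x).ne'
  · intro x
    refine ⟨fun i => ?_, ?_⟩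
    · have := hpos x
      positivity
    · rw [← Finset.sum_div, Finset.sum_add_distrib, div_eq_one_iff_eq (hpos x).ne']
      simp only [Finset.sum_const, Finset.card_univ, Fintype.card_fin, nsmul_eq_mul]
      push_cast
      have hk : (k : ℝ) + 1 ≠ 0 := by positivity
      rw [mul_div_cancel₀ _ hk]
      change t x + _ = _
      rcases le_total (t x) 1 with h | h
      · rw [max_eq_left (by linarith : 0 ≤ 1 - t x), max_eq_left h]; ring
      · rw [max_eq_right (by linarith : 1 - t x ≤ 0), max_eq_right h]; ring
  · intro x hx
    have h1 : t x = 1 := by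
      rw [← hx.2]
      exact Finset.sum_congr rfl fun j _ => max_eq_left (hx.1 j)
    ext i
    simp [h1, max_eq_left (hx.1 i)]

end PartFour

/-- For an `n`-manifold `M` and a finite set `S`, the evaluation map
`Germ(S,M) → Sing Conf(S,M)` is a principal fibration for the simplicial group
`Germ₀(ℝⁿ)^S`: in each simplicial degree `k`,
(1) (surjectivity on `k`-simplices) every continuous family of configurations
parametrized by the `k`-simplex is the family of origin values of some `S`-germ;
(2) (transitivity of the action on fibers) any two `S`-germs with the same origin
values differ by the right action of an element of `Germ₀(ℝⁿ)^S`;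
(3) (freeness of the action) any element of `Germ₀(ℝⁿ)^S` fixing some `S`-germ is the
identity germ.  Hence the induced map `Germ(S,M)ₖ/(Germ₀(ℝⁿ)^S)ₖ → Sing(Conf(S,M))ₖ`
is a bijection for every `k`. -/
theorem statement6 (n k : ℕ) (S : Type*) [Fintype S] [TopologicalSpace S]
    [DiscreteTopology S] (M : Type*) [TopologicalSpace M]
    [ChartedSpace (EuclideanSpace ℝ (Fin n)) M] [T2Space M] [SecondCountableTopology M] :
    -- (1) surjectivity onto `Sing Conf(S,M)ₖ`
    (∀ c : (Fin (k + 1) → ℝ) → S → M,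
      ContinuousOn (fun p : (Fin (k + 1) → ℝ) × S => c p.1 p.2)
        ((stdSimplex ℝ (Fin (k + 1))) ×ˢ (Set.univ : Set S)) →
      (∀ x ∈ stdSimplex ℝ (Fin (k + 1)), Function.Injective (c x)) →
      ∃ σ : GermSRep n k S M, ∀ x ∈ stdSimplex ℝ (Fin (k + 1)), ∀ p : S,
        σ.σ x p 0 = c x p) ∧
    -- (2) transitivity of the `Germ₀(ℝⁿ)^S`-action on each fiber
    (∀ σ τ : GermSRep n k S M,
      (∀ x ∈ stdSimplex ℝ (Fin (k + 1)), ∀ p : S, σ.σ x p 0 = τ.σ x p 0) →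
      ∃ g : S → GermZeroRep n k, ∃ s : ℝ, 0 < s ∧
        ∀ x ∈ stdSimplex ℝ (Fin (k + 1)), ∀ p : S,
          ∀ z ∈ ball (0 : EuclideanSpace ℝ (Fin n)) s,
            (g p).σ x z ∈ ball (0 : EuclideanSpace ℝ (Fin n)) σ.r ∧
            σ.σ x p ((g p).σ x z) = τ.σ x p z) ∧
    -- (3) freeness of the action
    (∀ (σ : GermSRep n k S M) (g : S → GermZeroRep n k),
      (∃ s : ℝ, 0 < s ∧ ∀ x ∈ stdSimplex ℝ (Fin (k + 1)), ∀ p : S,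
        ∀ z ∈ ball (0 : EuclideanSpace ℝ (Fin n)) s,
          (g p).σ x z ∈ ball (0 : EuclideanSpace ℝ (Fin n)) σ.r ∧
          σ.σ x p ((g p).σ x z) = σ.σ x p z) →
      ∀ p : S, ∃ s : ℝ, 0 < s ∧ ∀ x ∈ stdSimplex ℝ (Fin (k + 1)),
        ∀ z ∈ ball (0 : EuclideanSpace ℝ (Fin n)) s, (g p).σ x z = z) := by
  classical
  obtain ⟨ρ, hρ, hρK, hρid⟩ := simplex_retract k
  have hK : IsCompact (stdSimplex ℝ (Fin (k + 1))) := isCompact_stdSimplex ℝ (Fin (k + 1))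
  have hslice : ∀ (σ : GermSRep n k S M) (p : S), ContinuousOn
      (fun q : (Fin (k + 1) → ℝ) × EuclideanSpace ℝ (Fin n) => σ.σ q.1 p q.2)
      ((stdSimplex ℝ (Fin (k + 1))) ×ˢ ball (0 : EuclideanSpace ℝ (Fin n)) σ.r) := by
    intro σ p
    exact σ.cont.comp
      (f := fun q : (Fin (k + 1) → ℝ) × EuclideanSpace ℝ (Fin n) => (q.1, p, q.2))
      (by fun_prop) (fun q hq => ⟨hq.1, Set.mem_univ _, hq.2⟩)
  have hinj : ∀ (σ : GermSRep n k S M) (p : S), ∀ x ∈ stdSimplex ℝ (Fin (k + 1)),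
      Set.InjOn (σ.σ x p) (ball (0 : EuclideanSpace ℝ (Fin n)) σ.r) := by
    intro σ p x hx z hz w hw h
    have hz1 : (p, z) ∈ (Set.univ : Set S) ×ˢ ball (0 : EuclideanSpace ℝ (Fin n)) σ.r :=
      Set.mk_mem_prod (Set.mem_univ p) hz
    have hw1 : (p, w) ∈ (Set.univ : Set S) ×ˢ ball (0 : EuclideanSpace ℝ (Fin n)) σ.r :=
      Set.mk_mem_prod (Set.mem_univ p) hw
    have he : (p, z) = (p, w) := σ.inj x hx hz1 hw1 h
    exact congrArg Prod.snd he
  have hmin : ∀ f : S → ℝ, (∀ p, 0 < f p) → ∃ s > 0, ∀ p, s ≤ f p := by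
    intro f hf
    have h : ∀ᶠ s in nhdsWithin (0 : ℝ) (Set.Ioi 0), ∀ p, s ≤ f p :=
      Filter.eventually_all.2 fun p =>
        nhdsWithin_le_nhds ((eventually_le_nhds (hf p)))
    obtain ⟨s, h1, h2⟩ := (h.and self_mem_nhdsWithin).exists
    exact ⟨s, h2, h1⟩
  refine ⟨?_, ?_, ?_⟩
  · intro c hc hcinj
    have hcp : ∀ p, Continuous (fun x => c (ρ x) p) := by
      intro p
      exact hc.comp_continuous (f := fun x => (ρ x, p)) (by fun_prop)
        (fun x => ⟨hρK x, Set.mem_univ _⟩)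
    have hT : ∀ p, TrivOn (EuclideanSpace ℝ (Fin n)) (fun x => c (ρ x) p)
        (Set.Icc (0 : Fin (k + 1) → ℝ) 1) := fun p => triv_box _ (hcp p) 0 1 zero_le_one
    choose r hr σ hσc hσi hσ0 using hT
    have hsub : stdSimplex ℝ (Fin (k + 1)) ⊆ Set.Icc 0 1 := by
      intro x hx
      refine ⟨hx.1, fun i => ?_⟩
      rw [Pi.one_apply, ← hx.2]
      exact Finset.single_le_sum (fun j _ => hx.1 j) (Finset.mem_univ i)
    obtain ⟨r0, hr0, hr0r⟩ := hmin r hr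
    have hσc' : ∀ p, ContinuousOn
        (fun q : (Fin (k + 1) → ℝ) × EuclideanSpace ℝ (Fin n) => σ p q.1 q.2)
        ((stdSimplex ℝ (Fin (k + 1))) ×ˢ ball (0 : EuclideanSpace ℝ (Fin n)) r0) :=
      fun p => (hσc p).mono (Set.prod_mono hsub (ball_subset_ball (hr0r p)))
    have hσ0' : ∀ p, ∀ x ∈ stdSimplex ℝ (Fin (k + 1)), σ p x 0 = c x p := by
      intro p x hx
      have h := hσ0 p x (hsub hx)
      simp only [hρid x hx] at h
      exact h
    obtain ⟨s, hs, hsr, hsep⟩ := tube_aux hK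
      (fun x (zw : EuclideanSpace ℝ (Fin n) × EuclideanSpace ℝ (Fin n)) =>
        ∀ p q, p ≠ q → σ p x zw.1 ≠ σ q x zw.2) r0 hr0 (by
      intro x hx
      refine Filter.eventually_all.2 fun p => Filter.eventually_all.2 fun q => ?_
      by_cases hpq : p = q
      · exact Filter.Eventually.of_forall fun _ h => absurd hpq h
      have hA : ContinuousWithinAt (fun u : (Fin (k + 1) → ℝ) ×
          (EuclideanSpace ℝ (Fin n) × EuclideanSpace ℝ (Fin n)) => σ p u.1 u.2.1)
          ((stdSimplex ℝ (Fin (k + 1))) ×ˢ ball 0 r0) (x, 0) := by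
        have : ContinuousOn (fun u : (Fin (k + 1) → ℝ) ×
          (EuclideanSpace ℝ (Fin n) × EuclideanSpace ℝ (Fin n)) => σ p u.1 u.2.1)
          ((stdSimplex ℝ (Fin (k + 1))) ×ˢ ball 0 r0) := by
          refine (hσc' p).comp (f := fun u : (Fin (k + 1) → ℝ) ×
            (EuclideanSpace ℝ (Fin n) × EuclideanSpace ℝ (Fin n)) => (u.1, u.2.1))
            (by fun_prop) ?_
          rintro ⟨y, z, w⟩ ⟨hy, hzw⟩
          refine ⟨hy, ?_⟩
          rw [← Prod.mk_zero_zero, ← ball_prod_same] at hzw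
          exact hzw.1
        exact this (x, 0) ⟨hx, mem_ball_self hr0⟩
      have hB : ContinuousWithinAt (fun u : (Fin (k + 1) → ℝ) ×
          (EuclideanSpace ℝ (Fin n) × EuclideanSpace ℝ (Fin n)) => σ q u.1 u.2.2)
          ((stdSimplex ℝ (Fin (k + 1))) ×ˢ ball 0 r0) (x, 0) := by
        have : ContinuousOn (fun u : (Fin (k + 1) → ℝ) ×
          (EuclideanSpace ℝ (Fin n) × EuclideanSpace ℝ (Fin n)) => σ q u.1 u.2.2)
          ((stdSimplex ℝ (Fin (k + 1))) ×ˢ ball 0 r0) := by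
          refine (hσc' q).comp (f := fun u : (Fin (k + 1) → ℝ) ×
            (EuclideanSpace ℝ (Fin n) × EuclideanSpace ℝ (Fin n)) => (u.1, u.2.2))
            (by fun_prop) ?_
          rintro ⟨y, z, w⟩ ⟨hy, hzw⟩
          refine ⟨hy, ?_⟩
          rw [← Prod.mk_zero_zero, ← ball_prod_same] at hzw
          exact hzw.2
        exact this (x, 0) ⟨hx, mem_ball_self hr0⟩
      have hne : σ p x 0 ≠ σ q x 0 := by
        rw [hσ0' p x hx, hσ0' q x hx]
        exact fun h => hpq (hcinj x hx h)
      have hopen : IsOpen {m : M × M | m.1 ≠ m.2} := isOpen_ne_fun continuous_fst continuous_snd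
      have hev := (hA.prodMk hB) (hopen.mem_nhds (x := (σ p x 0, σ q x 0)) hne)
      filter_upwards [hev] with u hu _
      exact hu)
    refine ⟨⟨s, hs, fun x p z => σ p x z, ?_, ?_⟩, fun x hx p => hσ0' p x hx⟩
    · rintro ⟨x, p, z⟩ ⟨hx, -, hz⟩
      have h1 : ContinuousWithinAt
          (fun u : (Fin (k + 1) → ℝ) × S × EuclideanSpace ℝ (Fin n) => σ p u.1 u.2.2)
          ((stdSimplex ℝ (Fin (k + 1))) ×ˢ
            ((Set.univ : Set S) ×ˢ ball (0 : EuclideanSpace ℝ (Fin n)) s)) (x, p, z) := by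
        have h2 : ContinuousOn
          (fun u : (Fin (k + 1) → ℝ) × S × EuclideanSpace ℝ (Fin n) => σ p u.1 u.2.2)
          ((stdSimplex ℝ (Fin (k + 1))) ×ˢ
            ((Set.univ : Set S) ×ˢ ball (0 : EuclideanSpace ℝ (Fin n)) s)) :=
          (hσc' p).comp (f := fun u : (Fin (k + 1) → ℝ) × S × EuclideanSpace ℝ (Fin n) =>
            (u.1, u.2.2)) (by fun_prop) (fun u hu => ⟨hu.1, ball_subset_ball hsr hu.2.2⟩)
        exact h2 _ ⟨hx, Set.mem_univ _, hz⟩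
      refine h1.congr_of_eventuallyEq ?_ rfl
      have h3 : ∀ᶠ u : (Fin (k + 1) → ℝ) × S × EuclideanSpace ℝ (Fin n) in
          nhds (x, p, z), u.2.1 = p := by
        have hcont : Continuous
          (fun u : (Fin (k + 1) → ℝ) × S × EuclideanSpace ℝ (Fin n) => u.2.1) := by fun_prop
        exact ((isOpen_discrete {p}).preimage hcont).mem_nhds rfl
      filter_upwards [nhdsWithin_le_nhds h3] with u hu
      simp only [hu]
    · rintro x hx ⟨p, z⟩ ⟨-, hz⟩ ⟨q, w⟩ ⟨-, hw⟩ h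
      simp only at h hz hw
      by_cases hpq : p = q
      · subst hpq
        exact Prod.ext rfl (hσi p x (hsub hx) (ball_subset_ball (hsr.trans (hr0r p)) hz)
          (ball_subset_ball (hsr.trans (hr0r p)) hw) h)
      · refine absurd h (hsep x hx (z, w) ?_ p q hpq)
        rw [← Prod.mk_zero_zero, ← ball_prod_same]
        exact ⟨hz, hw⟩
  · intro σ τ h0
    have hT := fun p => trans_lem hK ρ hρ hρK hρid σ.r σ.r_pos (fun x z => σ.σ x p z)
      (hslice σ p) (hinj σ p) τ.r τ.r_pos (fun x z => τ.σ x p z) (hslice τ p)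
      (fun x hx => h0 x hx p)
    choose s hs hsr g hgc hg using hT
    obtain ⟨s0, hs0, hs0s⟩ := hmin s hs
    refine ⟨fun p => ⟨s p, hs p, g p, hgc p, ?_, ?_⟩, s0, hs0, ?_⟩
    · intro x hx a ha b hb hab
      refine hinj τ p x hx (ball_subset_ball (hsr p) ha) (ball_subset_ball (hsr p) hb) ?_
      rw [← (hg p x hx a ha).2, ← (hg p x hx b hb).2, hab]
    · intro x hx
      obtain ⟨ha, hb⟩ := hg p x hx 0 (mem_ball_self (hs p))
      exact hinj σ p x hx ha (mem_ball_self σ.r_pos) (hb.trans (h0 x hx p).symm)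
    · intro x hx p z hz
      exact hg p x hx z (ball_subset_ball (hs0s p) hz)
  · rintro σ g ⟨s, hs, h⟩ p
    refine ⟨min s σ.r, lt_min hs σ.r_pos, fun x hx z hz => ?_⟩
    obtain ⟨h1, h2⟩ := h x hx p z (ball_subset_ball (min_le_left _ _) hz)
    exact hinj σ p x hx h1 (ball_subset_ball (min_le_right _ _) hz) h2
end
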